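/- (G.Horváth–Lángi) Let K be a convex body in EuclideanSpace ℝ (Fin d), d ≥ 2. Then sup { vol(convexHull ℝ (K ∪ ((2•a) − K))) : a ∈ EuclideanSpace ℝ (Fin d), K ∩ ((2•a) − K) ≠ ∅ } ≥ (1 + 2·v_{d−1}/v_d) · vol(K), where (2•a) − K = {2a − x : x ∈ K} is the reflection of K about the point a, and equality holds if and only if K is an ellipsoid, i.e., K is the image of the closed unit Euclidean ball under an invertible affine map. (This proves the Rogers–Shephard conjecture for copies reflected about a point.) -/

import Mathlib

open MeasureTheory

/-- The volume of the closed unit ball of Euclidean `n`-space. -/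
noncomputable def unitBallVol (n : ℕ) : ℝ :=
  (volume (Metric.closedBall (0 : EuclideanSpace ℝ (Fin n)) 1)).toReal

/-- The reflection `(2•a) − K = {2a − x : x ∈ K}` of a set `K` about the point `a`. -/
def reflAbout {d : ℕ} (a : EuclideanSpace ℝ (Fin d)) (K : Set (EuclideanSpace ℝ (Fin d))) :
    Set (EuclideanSpace ℝ (Fin d)) :=
  (fun x => (2 : ℝ) • a - x) '' K

open Set Metric Filter Topology
open scoped ENNReal NNReal RealInnerProductSpace

/-- Euclidean `d`-space. -/
abbrev Eu (d : ℕ) := EuclideanSpace ℝ (Fin d)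

/-- Orthogonal coordinates along a unit vector `u`. -/
lemma exists_fiber {n : ℕ} (u : Eu (n+1)) (hu : ‖u‖ = 1) :
    ∃ Φ : Eu n →ₗᵢ[ℝ] Eu (n+1), (∀ y, ⟪u, Φ y⟫ = 0) ∧
      (∀ x, ∃ y, ∃ t : ℝ, x = Φ y + t • u) ∧
      MeasurePreserving (fun p : Eu n × ℝ => Φ p.1 + p.2 • u) (volume.prod volume) volume := by
  have hu0 : u ≠ 0 := by intro h; simp [h] at hu
  have : Fact (Module.finrank ℝ (Eu (n+1)) = n + 1) := ⟨by simp⟩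
  have hfr : Module.finrank ℝ (ℝ ∙ u)ᗮ = n := Submodule.finrank_orthogonal_span_singleton hu0
  let φ : Eu n ≃ₗᵢ[ℝ] (ℝ ∙ u)ᗮ :=
    (((stdOrthonormalBasis ℝ (ℝ ∙ u)ᗮ).reindex (finCongr hfr)).repr).symm
  let Φ : Eu n →ₗᵢ[ℝ] Eu (n+1) := ((ℝ ∙ u)ᗮ.subtypeₗᵢ).comp φ.toLinearIsometry
  have horth : ∀ y, ⟪u, Φ y⟫ = 0 := fun y =>
    Submodule.mem_orthogonal_singleton_iff_inner_right.1 (φ y).2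
  let L : WithLp 2 (Eu n × ℝ) →ₗ[ℝ] Eu (n+1) :=
    { toFun := fun p => Φ p.fst + p.snd • u
      map_add' := by intro p q; simp [add_smul]; abel
      map_smul' := by intro c p; simp [mul_smul] }
  let Li : WithLp 2 (Eu n × ℝ) →ₗᵢ[ℝ] Eu (n+1) :=
    { L with
      norm_map' := by
        intro p
        have h1 : ‖L p‖^2 = ‖p‖^2 := by
          rw [WithLp.prod_norm_sq_eq_of_L2]
          change ‖Φ p.fst + p.snd • u‖^2 = _
          rw [norm_add_sq_real, norm_smul, hu, real_inner_smul_right, real_inner_comm, horth]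
          simp
        exact (sq_eq_sq₀ (norm_nonneg _) (norm_nonneg _)).1 h1 }
  have hdim : Module.finrank ℝ (WithLp 2 (Eu n × ℝ)) = Module.finrank ℝ (Eu (n+1)) := by
    rw [(WithLp.linearEquiv 2 ℝ (Eu n × ℝ)).finrank_eq]; simp
  let Le := Li.toLinearIsometryEquiv hdim
  refine ⟨Φ, horth, ?_, ?_⟩
  · intro x
    refine ⟨(Le.symm x).fst, (Le.symm x).snd, ?_⟩
    exact (Le.apply_symm_apply x).symm
  · have h := (Le.measurePreserving).comp (WithLp.volume_preserving_toLp (Eu n) ℝ)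
    exact h

lemma vol_fiber {n : ℕ} {u : Eu (n+1)} {Φ : Eu n →ₗᵢ[ℝ] Eu (n+1)}
    (hΦ : MeasurePreserving (fun p : Eu n × ℝ => Φ p.1 + p.2 • u) (volume.prod volume) volume)
    {X : Set (Eu (n+1))} (hX : MeasurableSet X) :
    volume X = ∫⁻ y, volume {t : ℝ | Φ y + t • u ∈ X} := by
  rw [← hΦ.measure_preimage hX.nullMeasurableSet, Measure.prod_apply (hΦ.measurable hX)]
  rfl

lemma measurable_fiber {n : ℕ} {u : Eu (n+1)} {Φ : Eu n →ₗᵢ[ℝ] Eu (n+1)}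
    (hΦ : MeasurePreserving (fun p : Eu n × ℝ => Φ p.1 + p.2 • u) (volume.prod volume) volume)
    {X : Set (Eu (n+1))} (hX : MeasurableSet X) :
    Measurable (fun y => volume {t : ℝ | Φ y + t • u ∈ X}) :=
  measurable_measure_prodMk_left (hΦ.measurable hX)

/-- Compact convex subsets of a line inside a compact convex set are empty or intervals. -/
lemma fiber_Icc {d : ℕ} {u : Eu d} (hu : ‖u‖ = 1) {X : Set (Eu d)} (hX : IsCompact X)
    (hXc : Convex ℝ X) (x : Eu d) :
    {t : ℝ | x + t • u ∈ X} = ∅ ∨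
      ∃ a b : ℝ, a ≤ b ∧ {t : ℝ | x + t • u ∈ X} = Icc a b := by
  set I := {t : ℝ | x + t • u ∈ X} with hI
  have hcl : IsClosed I := hX.isClosed.preimage (by fun_prop)
  have hconv : Convex ℝ I := by
    intro s hs t ht a b ha hb hab
    have := hXc hs ht ha hb hab
    simp only [hI, mem_setOf_eq] at *
    convert this using 1
    have : x = (a + b) • x := by rw [hab, one_smul]
    conv_lhs => rw [this]
    simp only [smul_add, add_smul, smul_eq_mul, mul_smul]; abel
  have hbd : Bornology.IsBounded I := by
    obtain ⟨R, hR⟩ := hX.isBounded.exists_norm_le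
    refine (isBounded_iff_forall_norm_le).2 ⟨R + ‖x‖, fun t ht => ?_⟩
    have h1 := hR _ ht
    have h2 : ‖t • u‖ ≤ ‖x + t • u‖ + ‖x‖ := by
      have := norm_sub_le (x + t • u) x
      simpa using this
    rw [norm_smul, hu, mul_one] at h2
    linarith
  have hcomp : IsCompact I := isCompact_of_isClosed_isBounded hcl hbd
  rcases I.eq_empty_or_nonempty with h | h
  · exact Or.inl h
  · right
    have := eq_Icc_of_connected_compact ⟨h, hconv.isPreconnected⟩ hcomp
    exact ⟨sInf I, sSup I, csInf_le_csSup h hcomp.bddBelow hcomp.bddAbove, this⟩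

/-- fibrewise half-sum of two sets in direction `u` -/
def Hf {d : ℕ} (u : Eu d) (X Y : Set (Eu d)) : Set (Eu d) :=
  {z | ∃ t : ℝ, z + t • u ∈ X ∧ z - t • u ∈ Y}

lemma Hf_mono {d : ℕ} {u : Eu d} {X Y X' Y' : Set (Eu d)} (h : X ⊆ X') (h' : Y ⊆ Y') :
    Hf u X Y ⊆ Hf u X' Y' := fun _ ⟨t, h1, h2⟩ => ⟨t, h h1, h' h2⟩

lemma Hf_convex {d : ℕ} {u : Eu d} {X Y : Set (Eu d)} (hX : Convex ℝ X) (hY : Convex ℝ Y) :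
    Convex ℝ (Hf u X Y) := by
  rintro x ⟨s, hs1, hs2⟩ y ⟨t, ht1, ht2⟩ a b ha hb hab
  refine ⟨a * s + b * t, ?_, ?_⟩
  · convert hX hs1 ht1 ha hb hab using 1
    simp only [smul_add, add_smul, mul_smul]; abel
  · convert hY hs2 ht2 ha hb hab using 1
    simp only [smul_sub, add_smul, mul_smul]; abel

lemma Hf_compact {d : ℕ} {u : Eu d} {X Y : Set (Eu d)} (hX : IsCompact X) (hY : IsCompact Y) :
    IsCompact (Hf u X Y) := by
  have hcl : IsClosed {p : Eu d × Eu d | p.1 - p.2 ∈ (ℝ ∙ u)} :=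
    (Submodule.closed_of_finiteDimensional (ℝ ∙ u)).preimage (by fun_prop)
  have h := ((hX.prod hY).inter_right hcl).image
    (f := fun p : Eu d × Eu d => (1/2 : ℝ) • (p.1 + p.2)) (by fun_prop)
  convert h using 1
  ext z
  constructor
  · rintro ⟨t, h1, h2⟩
    refine ⟨(z + t • u, z - t • u), ⟨⟨h1, h2⟩, ?_⟩, ?_⟩
    · refine Submodule.mem_span_singleton.2 ⟨2 * t, ?_⟩
      simp only [two_mul, add_smul]; abel
    · simp only; module
  · rintro ⟨⟨x, y⟩, ⟨⟨h1, h2⟩, h3⟩, rfl⟩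
    obtain ⟨t, ht⟩ := Submodule.mem_span_singleton.1 h3
    simp only at ht h1 h2 ⊢
    refine ⟨t / 2, ?_, ?_⟩
    · convert h1 using 1
      have : x = y + t • u := by rw [ht]; abel
      rw [this]; module
    · convert h2 using 1
      have : x = y + t • u := by rw [ht]; abel
      rw [this]; module

lemma vol_Hf_le {n : ℕ} {u : Eu (n+1)} (hu : ‖u‖ = 1) {X Y : Set (Eu (n+1))}
    (hX : IsCompact X) (hXc : Convex ℝ X) (hY : IsCompact Y) (hYc : Convex ℝ Y) :
    2 * volume (Hf u X Y) ≤ volume X + volume Y := by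
  obtain ⟨Φ, -, -, hΦ⟩ := exists_fiber u hu
  rw [vol_fiber hΦ hX.measurableSet, vol_fiber hΦ hY.measurableSet,
    vol_fiber hΦ (Hf_compact hX hY).measurableSet,
    ← lintegral_add_left (measurable_fiber hΦ hX.measurableSet),
    ← lintegral_const_mul _ (measurable_fiber hΦ (Hf_compact hX hY).measurableSet)]
  refine lintegral_mono fun y => ?_
  rcases fiber_Icc hu hX hXc (Φ y) with h1 | ⟨a, b, hab, h1⟩
  · have : {t : ℝ | Φ y + t • u ∈ Hf u X Y} = ∅ := by
      ext t; simp only [mem_setOf_eq, mem_empty_iff_false, iff_false]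
      rintro ⟨s, hs, -⟩
      have : t + s ∈ {t : ℝ | Φ y + t • u ∈ X} := by
        simp only [mem_setOf_eq, add_smul]; rwa [← add_assoc]
      rw [h1] at this; exact this
    rw [this]; simp
  rcases fiber_Icc hu hY hYc (Φ y) with h2 | ⟨a', b', hab', h2⟩
  · have : {t : ℝ | Φ y + t • u ∈ Hf u X Y} = ∅ := by
      ext t; simp only [mem_setOf_eq, mem_empty_iff_false, iff_false]
      rintro ⟨s, -, hs⟩
      have : t - s ∈ {t : ℝ | Φ y + t • u ∈ Y} := by
        simp only [mem_setOf_eq, sub_smul]; rwa [← add_sub_assoc]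
      rw [h2] at this; exact this
    rw [this]; simp
  have h3 : {t : ℝ | Φ y + t • u ∈ Hf u X Y} ⊆ Icc ((a + a')/2) ((b + b')/2) := by
    rintro t ⟨s, hs, hs'⟩
    have g1 : t + s ∈ {t : ℝ | Φ y + t • u ∈ X} := by
      simp only [mem_setOf_eq, add_smul]; rwa [← add_assoc]
    have g2 : t - s ∈ {t : ℝ | Φ y + t • u ∈ Y} := by
      simp only [mem_setOf_eq, sub_smul]; rwa [← add_sub_assoc]
    rw [h1] at g1; rw [h2] at g2
    constructor
    · linarith [g1.1, g2.1]
    · linarith [g1.2, g2.2]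
  rw [h1, h2]
  calc 2 * volume {t : ℝ | Φ y + t • u ∈ Hf u X Y}
      ≤ 2 * volume (Icc ((a + a')/2) ((b + b')/2)) := by gcongr
    _ = volume (Icc a b) + volume (Icc a' b') := by
      simp only [Real.volume_Icc]
      rw [← ENNReal.ofReal_add (by linarith) (by linarith)]
      rw [show (2 : ℝ≥0∞) = ENNReal.ofReal 2 by simp, ← ENNReal.ofReal_mul (by norm_num)]
      congr 1; ring

/-- the reflection in the hyperplane orthogonal to `u` -/
noncomputable def rho {d : ℕ} (u : Eu d) : Eu d ≃ₗᵢ[ℝ] Eu d := (ℝ ∙ u)ᗮ.reflection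

lemma rho_apply {d : ℕ} {u : Eu d} (hu : ‖u‖ = 1) (x : Eu d) :
    rho u x = x - (2 * ⟪u, x⟫) • u := by
  rw [rho, Submodule.reflection_orthogonal_apply, Submodule.reflection_singleton_apply]
  simp [hu]; module

lemma rho_rho {d : ℕ} (u x : Eu d) : rho u (rho u x) = x :=
  Submodule.reflection_reflection _ _

lemma mem_rho_image {d : ℕ} {u : Eu d} {K : Set (Eu d)} {x : Eu d} :
    x ∈ rho u '' K ↔ rho u x ∈ K := by
  constructor
  · rintro ⟨y, hy, rfl⟩; rwa [rho_rho]
  · intro h; exact ⟨_, h, rho_rho _ _⟩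

/-- Steiner symmetrization in direction `u` -/
noncomputable def St {d : ℕ} (u : Eu d) (K : Set (Eu d)) : Set (Eu d) := Hf u K (rho u '' K)

lemma St_convex {d : ℕ} {u : Eu d} {K : Set (Eu d)} (hK : Convex ℝ K) : Convex ℝ (St u K) :=
  Hf_convex hK (hK.linear_image (rho u).toLinearEquiv.toLinearMap)

lemma St_compact {d : ℕ} {u : Eu d} {K : Set (Eu d)} (hK : IsCompact K) : IsCompact (St u K) :=
  Hf_compact hK (hK.image (rho u).continuous)

lemma mem_St {d : ℕ} {u : Eu d} (hu : ‖u‖ = 1) {K : Set (Eu d)} {z : Eu d} :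
    z ∈ St u K ↔ ∃ t : ℝ, z + t • u ∈ K ∧ z + (t - 2 * ⟪u, z⟫) • u ∈ K := by
  unfold St Hf
  simp only [mem_setOf_eq, mem_rho_image]
  have : ∀ t : ℝ, rho u (z - t • u) = z + (t - 2 * ⟪u, z⟫) • u := by
    intro t
    rw [rho_apply hu, inner_sub_right, real_inner_smul_right, real_inner_self_eq_norm_sq, hu]
    module
  simp only [this]

lemma vol_St_ge {n : ℕ} {u : Eu (n+1)} (hu : ‖u‖ = 1) {K : Set (Eu (n+1))}
    (hK : IsCompact K) (hKc : Convex ℝ K) : volume K ≤ volume (St u K) := by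
  obtain ⟨Φ, hΦ0, -, hΦ⟩ := exists_fiber u hu
  rw [vol_fiber hΦ hK.measurableSet, vol_fiber hΦ (St_compact hK).measurableSet]
  refine lintegral_mono fun y => ?_
  rcases fiber_Icc hu hK hKc (Φ y) with h1 | ⟨a, b, hab, h1⟩
  · simp only [h1]; simp
  have h3 : Icc (-(b - a)/2) ((b-a)/2) ⊆ {t : ℝ | Φ y + t • u ∈ St u K} := by
    rintro t ⟨ht1, ht2⟩
    have key : ∀ s, s ∈ Icc a b → Φ y + s • u ∈ K := fun s hs => by
      rw [← h1] at hs; exact hs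
    simp only [mem_setOf_eq, mem_St hu]
    have hin : ⟪u, Φ y + t • u⟫ = t := by
      rw [inner_add_right, hΦ0, real_inner_smul_right, real_inner_self_eq_norm_sq, hu]; ring
    refine ⟨(a+b)/2, ?_, ?_⟩
    · have := key (t + (a+b)/2) ⟨by linarith, by linarith⟩
      rwa [add_smul, ← add_assoc] at this
    · have := key (-t + (a+b)/2) ⟨by linarith, by linarith⟩
      rw [hin]
      convert this using 1
      module
  calc volume {t : ℝ | Φ y + t • u ∈ K} = volume (Icc a b) := by rw [h1]
    _ = volume (Icc (-(b - a)/2) ((b-a)/2)) := by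
        simp only [Real.volume_Icc]; congr 1; ring
    _ ≤ _ := measure_mono h3

/-- hull of `K` with its reflected copy -/
def J {d : ℕ} (K : Set (Eu d)) (a : Eu d) : Set (Eu d) := convexHull ℝ (K ∪ reflAbout a K)

/-- volume of hull -/
noncomputable def F {d : ℕ} (K : Set (Eu d)) (a : Eu d) : ℝ≥0∞ := volume (J K a)

lemma mem_reflAbout {d : ℕ} {a x : Eu d} {K : Set (Eu d)} :
    x ∈ reflAbout a K ↔ (2:ℝ) • a - x ∈ K := by
  constructor
  · rintro ⟨y, hy, rfl⟩; simpa using hy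
  · intro h; exact ⟨_, h, by simp⟩

lemma reflAbout_convex {d : ℕ} {a : Eu d} {K : Set (Eu d)} (hK : Convex ℝ K) :
    Convex ℝ (reflAbout a K) := by
  have : reflAbout a K = (AffineEquiv.pointReflection ℝ a).toAffineMap '' K := by
    ext x
    simp [reflAbout, Equiv.pointReflection_apply, two_smul, sub_eq_add_neg,
      add_comm, add_assoc]
  rw [this]; exact hK.affine_image _

lemma mem_J {d : ℕ} {K : Set (Eu d)} (hK : Convex ℝ K) (hne : K.Nonempty) {a z : Eu d} :
    z ∈ J K a ↔ ∃ x ∈ K, ∃ y ∈ K, ∃ θ ∈ Icc (0:ℝ) 1,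
      z = (1-θ) • x + θ • ((2:ℝ) • a - y) := by
  rw [J, hK.convexHull_union (reflAbout_convex hK) hne (hne.image _), mem_convexJoin]
  constructor
  · rintro ⟨x, hx, _, ⟨y, hy, rfl⟩, hz⟩
    rw [segment_eq_image] at hz
    obtain ⟨θ, hθ, rfl⟩ := hz
    exact ⟨x, hx, y, hy, θ, hθ, rfl⟩
  · rintro ⟨x, hx, y, hy, θ, hθ, rfl⟩
    refine ⟨x, hx, _, ⟨y, hy, rfl⟩, ?_⟩
    rw [segment_eq_image]
    exact ⟨θ, hθ, rfl⟩

lemma J_convex {d : ℕ} (K : Set (Eu d)) (a : Eu d) : Convex ℝ (J K a) := convex_convexHull _ _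

lemma subset_J {d : ℕ} (K : Set (Eu d)) (a : Eu d) : K ⊆ J K a :=
  subset_union_left.trans (subset_convexHull _ _)

lemma J_mono {d : ℕ} {K K' : Set (Eu d)} (h : K ⊆ K') (a : Eu d) : J K a ⊆ J K' a :=
  convexHull_mono (union_subset_union h (image_mono h))

lemma J_compact {d : ℕ} {K : Set (Eu d)} (hK : IsCompact K) (hKc : Convex ℝ K) (a : Eu d) :
    IsCompact (J K a) := by
  rcases K.eq_empty_or_nonempty with rfl | hne
  · simp [J, reflAbout]
  have h := ((hK.prod (hK.prod (isCompact_Icc (a := (0:ℝ)) (b := 1))))).image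
    (f := fun p : Eu d × Eu d × ℝ => (1-p.2.2) • p.1 + p.2.2 • ((2:ℝ) • a - p.2.1)) (by fun_prop)
  convert h using 1
  ext z
  rw [mem_J hKc hne]
  constructor
  · rintro ⟨x, hx, y, hy, θ, hθ, rfl⟩
    exact ⟨(x, y, θ), ⟨hx, hy, hθ⟩, rfl⟩
  · rintro ⟨⟨x, y, θ⟩, ⟨hx, hy, hθ⟩, rfl⟩
    exact ⟨x, hx, y, hy, θ, hθ, rfl⟩

lemma inter_refl_nonempty {d : ℕ} {K : Set (Eu d)} (hK : Convex ℝ K) (a : Eu d) :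
    (K ∩ reflAbout a K).Nonempty ↔ a ∈ K := by
  constructor
  · rintro ⟨x, hx, hx'⟩
    rw [mem_reflAbout] at hx'
    have := hK hx hx' (a := 1/2) (b := 1/2) (by norm_num) (by norm_num) (by norm_num)
    convert this using 1; module
  · intro h
    exact ⟨a, h, by rw [mem_reflAbout]; convert h using 1; module⟩

lemma F_lt_top {d : ℕ} {K : Set (Eu d)} (hK : IsCompact K) (hKc : Convex ℝ K) (a : Eu d) :
    F K a < ∞ := (J_compact hK hKc a).measure_lt_top

lemma F_mono {d : ℕ} {K K' : Set (Eu d)} (h : K ⊆ K') (a : Eu d) : F K a ≤ F K' a :=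
  measure_mono (J_mono h a)

lemma vol_le_F {d : ℕ} (K : Set (Eu d)) (a : Eu d) : volume K ≤ F K a :=
  measure_mono (subset_J K a)

lemma J_affine {d : ℕ} (T : Eu d →ᵃ[ℝ] Eu d) (K : Set (Eu d)) (a : Eu d) :
    J (T '' K) (T a) = T '' J K a := by
  have h : reflAbout (T a) (T '' K) = T '' reflAbout a K := by
    ext z
    simp only [reflAbout, mem_image, exists_exists_and_eq_and]
    have key : ∀ x, T ((2:ℝ) • a - x) = (2:ℝ) • T a - T x := by
      intro x
      have h1 := T.map_vadd a (a - x)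
      have h2 := T.linearMap_vsub a x
      simp only [vsub_eq_sub, vadd_eq_add] at h1 h2
      rw [h2] at h1
      rw [show (2:ℝ) • a - x = a - x + a by module, h1]; module
    simp only [key]
  rw [J, J, h, ← image_union, AffineMap.image_convexHull]

lemma F_rho {d : ℕ} (u : Eu d) (K : Set (Eu d)) (a : Eu d) :
    F (rho u '' K) (rho u a) = F K a := by
  have h := J_affine ((rho u).toLinearEquiv.toLinearMap.toAffineMap) K a
  have h' : J (rho u '' K) (rho u a) = rho u '' J K a := h
  rw [F, h', F]
  rw [← (rho u).measurePreserving.measure_preimage_equiv (f := (rho u).toHomeomorph.toMeasurableEquiv)]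
  congr 1
  exact preimage_image_eq _ (rho u).injective

lemma F_rho' {d : ℕ} (u : Eu d) (K : Set (Eu d)) (a : Eu d) :
    F (rho u '' K) a = F K (rho u a) := by
  rw [← F_rho u K, rho_rho]

lemma F_translate {d : ℕ} (z : Eu d) (K : Set (Eu d)) (a : Eu d) :
    F ((fun x => z + x) '' K) (z + a) = F K a := by
  have h := J_affine ((AffineEquiv.constVAdd ℝ (Eu d) z).toAffineMap) K a
  have h' : J ((fun x => z + x) '' K) (z + a) = (fun x => z + x) '' J K a := h
  rw [F, h', F, image_add_left, measure_preimage_add]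

lemma J_Hf {d : ℕ} {u : Eu d} {X Y : Set (Eu d)} (hX : Convex ℝ X) (hY : Convex ℝ Y)
    (a : Eu d) (t : ℝ) :
    J (Hf u X Y) a ⊆ Hf u (J X (a + t • u)) (J Y (a - t • u)) := by
  intro z hz
  rcases (Hf u X Y).eq_empty_or_nonempty with he | hne
  · simp [J, reflAbout, he] at hz
  have hXn : X.Nonempty := by obtain ⟨x, t, h, -⟩ := hne; exact ⟨_, h⟩
  have hYn : Y.Nonempty := by obtain ⟨x, t, -, h⟩ := hne; exact ⟨_, h⟩
  rw [mem_J (Hf_convex hX hY) hne] at hz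
  obtain ⟨x, ⟨s, hs1, hs2⟩, y, ⟨r, hr1, hr2⟩, θ, hθ, rfl⟩ := hz
  refine ⟨(1-θ) * s + θ * (2 * t - r), ?_, ?_⟩
  · rw [mem_J hX hXn]
    exact ⟨_, hs1, _, hr1, θ, hθ, by module⟩
  · rw [mem_J hY hYn]
    exact ⟨_, hs2, _, hr2, θ, hθ, by module⟩

lemma rho_image_convex {d : ℕ} {u : Eu d} {K : Set (Eu d)} (hK : Convex ℝ K) :
    Convex ℝ (rho u '' K) := hK.linear_image (rho u).toLinearEquiv.toLinearMap

lemma rho_image_compact {d : ℕ} {u : Eu d} {K : Set (Eu d)} (hK : IsCompact K) :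
    IsCompact (rho u '' K) := hK.image (rho u).continuous

lemma F_St_le {n : ℕ} {u : Eu (n+1)} (hu : ‖u‖ = 1) {K L : Set (Eu (n+1))}
    (hK : IsCompact K) (hKc : Convex ℝ K) {c : ℝ≥0∞} (h : ∀ a ∈ L, F K a ≤ c) :
    ∀ a ∈ St u L, F (St u K) a ≤ c := by
  rintro a ⟨t, h1, h2⟩
  rw [mem_rho_image] at h2
  have e1 := h _ h1
  have e2 := h _ h2
  rw [← F_rho'] at e2
  have e3 := vol_Hf_le hu (J_compact hK hKc (a + t • u)) (J_convex _ _)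
    (J_compact (rho_image_compact (u := u) hK) (rho_image_convex hKc) (a - t • u)) (J_convex _ _)
  have e4 : 2 * F (St u K) a ≤ 2 * c := by
    calc 2 * F (St u K) a ≤ _ := mul_le_mul_right (measure_mono (J_Hf hKc (rho_image_convex hKc) a t)) 2
      _ ≤ _ := e3
      _ ≤ c + c := add_le_add e1 e2
      _ = 2 * c := (two_mul c).symm
  exact (ENNReal.mul_le_mul_iff_right (by norm_num) (by norm_num)).1 e4

lemma F_mid {n : ℕ} {K : Set (Eu (n+1))}
    (hK : IsCompact K) (hKc : Convex ℝ K) {c : ℝ≥0∞} {a b : Eu (n+1)} (ha : F K a ≤ c)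
    (hb : F K b ≤ c) : F K ((1/2:ℝ) • (a + b)) ≤ c := by
  by_cases hab : a = b
  · subst hab
    rwa [show (1/2:ℝ) • (a + a) = a by module]
  have hn : ‖a - b‖ ≠ 0 := norm_ne_zero_iff.2 (sub_ne_zero.2 hab)
  set u : Eu (n+1) := ‖a-b‖⁻¹ • (a - b) with hu'
  have hu : ‖u‖ = 1 := by rw [hu', norm_smul, norm_inv, norm_norm, inv_mul_cancel₀ hn]
  have e1 : (1/2:ℝ) • (a + b) + (‖a-b‖/2) • u = a := by
    rw [hu', smul_smul, show ‖a-b‖/2 * ‖a-b‖⁻¹ = 1/2 by field_simp]; module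
  have e2 : (1/2:ℝ) • (a + b) - (‖a-b‖/2) • u = b := by
    rw [hu', smul_smul, show ‖a-b‖/2 * ‖a-b‖⁻¹ = 1/2 by field_simp]; module
  have h0 : K ⊆ Hf u K K := fun x hx => ⟨0, by simpa using hx, by simpa using hx⟩
  have h1 := J_Hf (u := u) hKc hKc ((1/2:ℝ) • (a + b)) (‖a-b‖/2)
  rw [e1, e2] at h1
  have e3 := vol_Hf_le hu (J_compact hK hKc a) (J_convex _ _) (J_compact hK hKc b) (J_convex _ _)
  have e4 : 2 * F K ((1/2:ℝ) • (a + b)) ≤ 2 * c := by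
    calc 2 * F K ((1/2:ℝ) • (a + b)) ≤ _ := mul_le_mul_right (measure_mono ((J_mono h0 _).trans h1)) 2
      _ ≤ _ := e3
      _ ≤ c + c := add_le_add ha hb
      _ = 2 * c := (two_mul c).symm
  exact (ENNReal.mul_le_mul_iff_right (by norm_num) (by norm_num)).1 e4

/-- hull for centrally symmetric sets is a sweep along a segment -/
lemma mem_J_symm {d : ℕ} {K : Set (Eu d)} (hK : Convex ℝ K) (hne : K.Nonempty)
    (hs : ∀ x ∈ K, -x ∈ K) {a z : Eu d} :
    z ∈ J K a ↔ ∃ s ∈ Icc (0:ℝ) 2, z - s • a ∈ K := by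
  rw [mem_J hK hne]
  constructor
  · rintro ⟨x, hx, y, hy, θ, hθ, rfl⟩
    refine ⟨2 * θ, ⟨by linarith [hθ.1], by linarith [hθ.2]⟩, ?_⟩
    convert hK hx (hs y hy) (sub_nonneg.2 hθ.2) hθ.1 (by ring) using 1
    module
  · rintro ⟨s, hs', h⟩
    refine ⟨_, h, _, hs _ h, s / 2, ⟨by linarith [hs'.1], by linarith [hs'.2]⟩, by module⟩

lemma exists_unit_smul {n : ℕ} (a : Eu (n+1)) : ∃ u : Eu (n+1), ‖u‖ = 1 ∧ a = ‖a‖ • u := by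
  by_cases h : a = 0
  · refine ⟨EuclideanSpace.single 0 1, by simp, by simp [h]⟩
  · have hn : ‖a‖ ≠ 0 := norm_ne_zero_iff.2 h
    refine ⟨‖a‖⁻¹ • a, by rw [norm_smul, norm_inv, norm_norm, inv_mul_cancel₀ hn], ?_⟩
    rw [smul_smul, mul_inv_cancel₀ hn, one_smul]

lemma F_ball {n : ℕ} {r : ℝ} (hr : 0 ≤ r) (a : Eu (n+1)) :
    F (closedBall (0 : Eu (n+1)) r) a = volume (closedBall (0 : Eu (n+1)) r) +
      ENNReal.ofReal (2 * ‖a‖) * volume (closedBall (0 : Eu n) r) := by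
  obtain ⟨u, hu, ha⟩ := exists_unit_smul a
  set α := ‖a‖ with hα
  have hα0 : 0 ≤ α := norm_nonneg _
  obtain ⟨Φ, hΦ0, -, hΦ⟩ := exists_fiber u hu
  set B := closedBall (0 : Eu (n+1)) r with hB
  have hBc : IsCompact B := isCompact_closedBall _ _
  have hBv : Convex ℝ B := convex_closedBall _ _
  have hBn : B.Nonempty := ⟨0, by simp [hB, hr]⟩
  have hBs : ∀ x ∈ B, -x ∈ B := by intro x hx; simpa [hB] using hx
  rw [F, vol_fiber hΦ (J_compact hBc hBv a).measurableSet, vol_fiber hΦ hBc.measurableSet]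
  have hcb : MeasurableSet (closedBall (0 : Eu n) r) := isClosed_closedBall.measurableSet
  rw [← lintegral_indicator_const hcb (ENNReal.ofReal (2 * α)),
    ← lintegral_add_left (measurable_fiber hΦ hBc.measurableSet)]
  congr 1; ext y
  have hnorm : ∀ t : ℝ, Φ y + t • u ∈ B ↔ ‖y‖^2 + t^2 ≤ r^2 := by
    intro t
    rw [hB, mem_closedBall_zero_iff, ← sq_le_sq₀ (norm_nonneg _) hr, norm_add_sq_real, norm_smul, hu,
      real_inner_smul_right, real_inner_comm, hΦ0]
    simp
  by_cases hy : ‖y‖ ≤ r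
  · set h := Real.sqrt (r^2 - ‖y‖^2) with hh
    have h0 : 0 ≤ h := Real.sqrt_nonneg _
    have hsq : h^2 = r^2 - ‖y‖^2 := Real.sq_sqrt (by nlinarith [norm_nonneg y])
    have hI : ∀ t : ℝ, Φ y + t • u ∈ B ↔ t ∈ Icc (-h) h := by
      intro t
      rw [hnorm, mem_Icc, ← abs_le, ← sq_le_sq₀ (abs_nonneg _) h0, sq_abs, hsq]
      constructor <;> intro <;> linarith
    have f1 : {t : ℝ | Φ y + t • u ∈ B} = Icc (-h) h := by ext t; exact hI t
    have f2 : {t : ℝ | Φ y + t • u ∈ J B a} = Icc (-h) (h + 2 * α) := by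
      ext t
      rw [mem_setOf_eq, mem_J_symm hBv hBn hBs]
      have : ∀ s : ℝ, Φ y + t • u - s • a = Φ y + (t - s * α) • u := by
        intro s; rw [ha]; module
      simp only [this, hI, mem_Icc]
      constructor
      · rintro ⟨s, ⟨hs1, hs2⟩, h1, h2⟩
        constructor <;> nlinarith
      · rintro ⟨h1, h2⟩
        by_cases hth : t ≤ h
        · exact ⟨0, ⟨le_rfl, by norm_num⟩, by linarith, by linarith⟩
        · push Not at hth
          have hαp : 0 < α := by nlinarith
          refine ⟨(t - h)/α, ⟨by apply div_nonneg <;> linarith, ?_⟩, ?_⟩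
          · rw [div_le_iff₀ hαp]; linarith
          · rw [div_mul_cancel₀ _ hαp.ne']
            constructor <;> linarith
    rw [f1, f2, indicator_of_mem (by simpa using hy), Real.volume_Icc, Real.volume_Icc,
      ← ENNReal.ofReal_add (by linarith) (by linarith)]
    congr 1; ring
  · have hI : ∀ t : ℝ, ¬ Φ y + t • u ∈ B := by
      intro t
      rw [hnorm]
      push Not at hy ⊢
      nlinarith [sq_nonneg t]
    have f1 : {t : ℝ | Φ y + t • u ∈ B} = ∅ := by ext t; simpa using hI t
    have f2 : {t : ℝ | Φ y + t • u ∈ J B a} = ∅ := by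
      ext t
      rw [mem_setOf_eq, mem_J_symm hBv hBn hBs]
      have : ∀ s : ℝ, Φ y + t • u - s • a = Φ y + (t - s * α) • u := by
        intro s; rw [ha]; module
      simp only [this, hI]; simp
    rw [f1, f2, indicator_of_notMem (by simpa using hy)]; simp

lemma subset_of_vol_le {d : ℕ} {Z W : Set (Eu d)} (hZ : IsClosed Z) (hW : Convex ℝ W)
    (hWi : (interior W).Nonempty) (hZW : Z ⊆ W) (hv : volume W ≤ volume Z)
    (hfin : volume Z ≠ ∞) : W ⊆ Z := by
  have h0 : volume (W \ Z) = 0 := by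
    rw [measure_diff hZW hZ.nullMeasurableSet hfin, tsub_eq_zero_of_le hv]
  have h1 : interior W \ Z = ∅ := by
    have ho : IsOpen (interior W \ Z) := isOpen_interior.sdiff hZ
    by_contra hne
    have := ho.measure_pos volume (nonempty_iff_ne_empty.2 hne)
    exact this.ne' (measure_mono_null (diff_subset_diff_left interior_subset) h0)
  have h2 : interior W ⊆ Z := diff_eq_empty.1 h1
  calc W ⊆ closure W := subset_closure
    _ = closure (interior W) := (hW.closure_interior_eq_closure_of_nonempty_interior hWi).symm
    _ ⊆ Z := hZ.closure_subset_iff.2 h2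

lemma vol_zero_of_interior_empty {d : ℕ} {C : Set (Eu d)} (hC : Convex ℝ C)
    (h : interior C = ∅) : volume C = 0 := by
  refine measure_mono_null ?_ (hC.addHaar_frontier volume)
  rw [frontier, h, diff_empty]; exact subset_closure

/-- every point of `X` is within `δ` of `Y` -/
def Near {d : ℕ} (δ : ℝ) (X Y : Set (Eu d)) : Prop := ∀ x ∈ X, ∃ y ∈ Y, dist x y ≤ δ

lemma near_homothety {d : ℕ} {C C' : Set (Eu d)} {x0 : Eu d} {r ε : ℝ} (hr : 0 < r)
    (hε : 0 ≤ ε) (hεr : ε ≤ r) (hb : closedBall x0 r ⊆ C) (hC' : IsClosed C')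
    (hC'c : Convex ℝ C') (hn : Near ε C C') :
    AffineMap.homothety x0 (1 - ε / r) '' C ⊆ C' := by
  rintro _ ⟨x, hx, rfl⟩
  by_contra hw
  obtain ⟨f, s, hf1, hf2⟩ := geometric_hahn_banach_closed_point hC'c hC' hw
  obtain ⟨y, rfl⟩ := (InnerProductSpace.toDual ℝ (Eu d)).surjective f
  simp only [InnerProductSpace.toDual_apply_apply] at hf1 hf2
  have hfb : ∀ c ∈ C, ⟪y, c⟫ ≤ s + ε * ‖y‖ := by
    intro c hc
    obtain ⟨c', hc', hd⟩ := hn c hc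
    have h1 := hf1 c' hc'
    have h2 : ⟪y, c - c'⟫ ≤ ‖y‖ * ‖c - c'‖ := real_inner_le_norm _ _
    rw [inner_sub_right] at h2
    rw [dist_eq_norm] at hd
    nlinarith [norm_nonneg y]
  have hN : 0 < ‖y‖ := by
    rw [norm_pos_iff]
    rintro rfl
    obtain ⟨c', hc', -⟩ := hn x hx
    have := hf1 c' hc'
    simp at this hf2
    linarith
  have h1 := hfb x hx
  have h2 : ⟪y, x0 + (r / ‖y‖) • y⟫ ≤ s + ε * ‖y‖ := by
    refine hfb _ (hb ?_)
    rw [mem_closedBall, dist_eq_norm, add_sub_cancel_left, norm_smul, norm_div, norm_norm,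
      div_mul_cancel₀ _ hN.ne', Real.norm_of_nonneg hr.le]
  rw [inner_add_right, real_inner_smul_right, real_inner_self_eq_norm_sq,
    show r / ‖y‖ * ‖y‖^2 = r * ‖y‖ by field_simp] at h2
  rw [AffineMap.homothety_apply, vsub_eq_sub, vadd_eq_add, inner_add_right, real_inner_smul_right,
    inner_sub_right] at hf2
  set q := ε / r with hq
  have hq0 : 0 ≤ q := div_nonneg hε hr.le
  have hq1 : q ≤ 1 := (div_le_one hr).2 hεr
  have hqr : q * r = ε := div_mul_cancel₀ _ hr.ne'
  have : q * (r * ‖y‖) = ε * ‖y‖ := by rw [← mul_assoc, hqr]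
  nlinarith

lemma vol_le_of_near {d : ℕ} {C : Set (Eu d)} (hC : Convex ℝ C) {c : ℝ≥0∞}
    (h : ∀ ε > 0, ∃ C' : Set (Eu d), IsClosed C' ∧ Convex ℝ C' ∧ Near ε C C' ∧ volume C' ≤ c) :
    volume C ≤ c := by
  rcases (interior C).eq_empty_or_nonempty with he | ⟨x0, hx0⟩
  · rw [vol_zero_of_interior_empty hC he]; exact zero_le
  obtain ⟨r, hr, hb⟩ := Metric.nhds_basis_closedBall.mem_iff.1 (mem_interior_iff_mem_nhds.1 hx0)
  have key : ∀ ε, 0 < ε → ε < r →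
      ENNReal.ofReal |(1 - ε / r) ^ (Module.finrank ℝ (Eu d))| * volume C ≤ c := by
    intro ε hε hεr
    obtain ⟨C', h1, h2, h3, h4⟩ := h ε hε
    rw [← Measure.addHaar_image_homothety volume x0]
    exact (measure_mono (near_homothety hr hε.le hεr.le hb h1 h2 h3)).trans h4
  have ht : Tendsto (fun ε : ℝ => ENNReal.ofReal |(1 - ε / r) ^ (Module.finrank ℝ (Eu d))| * volume C)
      (𝓝[>] 0) (𝓝 (1 * volume C)) := by
    refine ENNReal.Tendsto.mul_const ?_ (Or.inl one_ne_zero)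
    have : Tendsto (fun ε : ℝ => ENNReal.ofReal |(1 - ε / r) ^ (Module.finrank ℝ (Eu d))|)
      (𝓝 0) (𝓝 (ENNReal.ofReal |(1 - 0 / r) ^ (Module.finrank ℝ (Eu d))|)) := by
      apply Continuous.tendsto (f := fun ε : ℝ => ENNReal.ofReal |(1 - ε / r) ^ (Module.finrank ℝ (Eu d))|)
      exact ENNReal.continuous_ofReal.comp (by fun_prop)
    simp only [zero_div, sub_zero, one_pow, abs_one, ENNReal.ofReal_one] at this
    exact this.mono_left nhdsWithin_le_nhds
  rw [one_mul] at ht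
  refine le_of_tendsto ht ?_
  filter_upwards [Ioo_mem_nhdsGT hr] with ε hε
  exact key ε hε.1 hε.2

lemma near_J {d : ℕ} {K K' : Set (Eu d)} (hK : Convex ℝ K) (hK' : Convex ℝ K')
    {a a' : Eu d} {δ δ' : ℝ} (hn : Near δ K K') (ha : dist a a' ≤ δ') :
    Near (δ + 2 * δ') (J K a) (J K' a') := by
  intro z hz
  have hne : K.Nonempty := by
    by_contra h
    rw [not_nonempty_iff_eq_empty] at h
    simp [J, reflAbout, h] at hz
  have hne' : K'.Nonempty := by
    obtain ⟨x, hx⟩ := hne; obtain ⟨y, hy, -⟩ := hn x hx; exact ⟨y, hy⟩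
  rw [mem_J hK hne] at hz
  obtain ⟨x, hx, y, hy, θ, hθ, rfl⟩ := hz
  obtain ⟨x', hx', hxd⟩ := hn x hx
  obtain ⟨y', hy', hyd⟩ := hn y hy
  refine ⟨(1-θ) • x' + θ • ((2:ℝ) • a' - y'), (mem_J hK' hne').2 ⟨x', hx', y', hy', θ, hθ, rfl⟩, ?_⟩
  rw [dist_eq_norm] at *
  have : (1-θ) • x + θ • ((2:ℝ) • a - y) - ((1-θ) • x' + θ • ((2:ℝ) • a' - y')) =
      (1-θ) • (x - x') + ((2*θ) • (a - a') + (-θ) • (y - y')) := by module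
  rw [this]
  have h1 := norm_add_le ((1-θ) • (x - x')) ((2*θ) • (a - a') + (-θ) • (y - y'))
  have h2 := norm_add_le ((2*θ) • (a - a')) ((-θ) • (y - y'))
  rw [norm_smul, Real.norm_of_nonneg (by linarith [hθ.2])] at h1
  rw [norm_smul, norm_smul, norm_neg, Real.norm_of_nonneg (by linarith [hθ.1] : 0 ≤ 2 * θ),
    Real.norm_of_nonneg hθ.1] at h2
  have h3 : (1-θ) * ‖x - x'‖ ≤ (1-θ) * δ := mul_le_mul_of_nonneg_left hxd (by linarith [hθ.2])
  have h4 : θ * ‖y - y'‖ ≤ θ * δ := mul_le_mul_of_nonneg_left hyd hθ.1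
  have h5 : 2 * θ * ‖a - a'‖ ≤ 2 * 1 * δ' := by
    have := hθ.1; have := hθ.2
    gcongr
  linarith

lemma near_refl {d : ℕ} (K : Set (Eu d)) : Near 0 K K := fun x hx => ⟨x, hx, by simp⟩

lemma F_closed {d : ℕ} {K : Set (Eu d)} (hK : IsCompact K) (hKc : Convex ℝ K) (c : ℝ≥0∞) :
    IsClosed {a | F K a ≤ c} := by
  refine isClosed_of_closure_subset fun a ha => ?_
  refine vol_le_of_near (J_convex K a) fun ε hε => ?_
  obtain ⟨b, hb, hd⟩ := Metric.mem_closure_iff.1 ha (ε/2) (by linarith)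
  refine ⟨J K b, (J_compact hK hKc b).isClosed, J_convex _ _, ?_, hb⟩
  convert near_J hKc hKc (near_refl K) hd.le using 1
  ring

lemma convex_of_midpoint {d : ℕ} {S : Set (Eu d)} (hS : IsClosed S)
    (hm : ∀ a ∈ S, ∀ b ∈ S, (1/2:ℝ) • (a + b) ∈ S) : Convex ℝ S := by
  intro x hx y hy
  -- dyadic argument via maximal gap on the line
  by_contra hcon
  rw [not_forall] at hcon
  obtain ⟨a, hcon⟩ := hcon
  push Not at hcon
  obtain ⟨b, ha, hb, hab, hnot⟩ := hcon
  set g : ℝ → Eu d := fun t => x + t • (y - x) with hg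
  have hgc : Continuous g := by fun_prop
  have hcl : IsClosed (g ⁻¹' S) := hS.preimage hgc
  have hgm : ∀ s t, (1/2:ℝ) • (g s + g t) = g ((s+t)/2) := by
    intro s t; simp only [hg]; module
  have h0 : (0:ℝ) ∈ g ⁻¹' S := by simpa [hg] using hx
  have h1 : (1:ℝ) ∈ g ⁻¹' S := by simpa [hg] using hy
  have hbn : b ∉ g ⁻¹' S := by
    intro h; apply hnot
    have : a = 1 - b := by linarith
    have e : a • x + b • y = g b := by simp only [hg, this]; module
    rw [e]; exact h
  have hb1 : b ≤ 1 := by linarith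
  -- left endpoint
  have hA : (g ⁻¹' S ∩ Icc 0 b).Nonempty := ⟨0, h0, le_rfl, hb⟩
  have hB : (g ⁻¹' S ∩ Icc b 1).Nonempty := ⟨1, h1, hb1, le_rfl⟩
  obtain ⟨p, ⟨hpS, hp⟩, hpm⟩ := (isCompact_Icc.inter_left hcl).exists_isGreatest hA
  obtain ⟨q, ⟨hqS, hq⟩, hqm⟩ := (isCompact_Icc.inter_left hcl).exists_isLeast hB
  have hpb : p < b := lt_of_le_of_ne hp.2 (fun h => hbn (h ▸ hpS))
  have hqb : b < q := lt_of_le_of_ne hq.1 (fun h => hbn (h ▸ hqS))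
  have hmid : (p+q)/2 ∈ g ⁻¹' S := by
    rw [mem_preimage, ← hgm]; exact hm _ hpS _ hqS
  rcases le_total ((p+q)/2) b with h | h
  · have := hpm ⟨hmid, by linarith [hp.1], h⟩
    linarith
  · have := hqm ⟨hmid, h, by linarith [hq.2]⟩
    linarith

lemma F_convex {n : ℕ} {K : Set (Eu (n+1))} (hK : IsCompact K) (hKc : Convex ℝ K) (c : ℝ≥0∞) :
    Convex ℝ {a | F K a ≤ c} :=
  convex_of_midpoint (F_closed hK hKc c) fun _ ha _ hb => F_mid hK hKc ha hb

open TopologicalSpace in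
lemma near_of_dist_lt {d : ℕ} {X Y : NonemptyCompacts (Eu d)} {ε : ℝ} (h : dist X Y < ε) :
    Near ε (X : Set (Eu d)) Y := by
  intro x hx
  rw [Metric.NonemptyCompacts.dist_eq] at h
  obtain ⟨y, hy, hd⟩ := exists_dist_lt_of_hausdorffDist_lt hx h
    (hausdorffEDist_ne_top_of_nonempty_of_bounded X.nonempty Y.nonempty X.isCompact.isBounded
      Y.isCompact.isBounded)
  exact ⟨y, hy, hd.le⟩

open TopologicalSpace in
lemma usc_vol {d : ℕ} (μ : Measure (Eu d)) [IsFiniteMeasureOnCompacts μ] :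
    UpperSemicontinuous (fun X : NonemptyCompacts (Eu d) => μ (X : Set (Eu d))) := by
  intro X y hy
  have ht := (tendsto_measure_cthickening_of_isCompact (μ := μ) X.isCompact).eventually_lt_const hy
  obtain ⟨ε, hε, hb⟩ := Metric.eventually_nhds_iff.1 ht
  have hε2 : μ (cthickening (ε/2) (X : Set (Eu d))) < y := hb (by
    rw [Real.dist_eq, sub_zero, abs_of_pos (by linarith)]; linarith)
  rw [Metric.eventually_nhds_iff]
  refine ⟨ε/2, by linarith, fun Y hY => lt_of_le_of_lt (measure_mono ?_) hε2⟩
  intro z hz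
  obtain ⟨w, hw, hd⟩ := near_of_dist_lt hY z hz
  exact mem_cthickening_of_dist_le z w _ _ hw hd

lemma convex_of_near {d : ℕ} {X : Set (Eu d)} (hX : IsClosed X)
    (h : ∀ ε > 0, ∃ Y : Set (Eu d), Convex ℝ Y ∧ Near ε X Y ∧ Near ε Y X) : Convex ℝ X := by
  intro x hx y hy a b ha hb hab
  rw [← hX.closure_eq, Metric.mem_closure_iff]
  intro ε hε
  obtain ⟨Y, hY, h1, h2⟩ := h (ε/3) (by linarith)
  obtain ⟨x', hx', hdx⟩ := h1 x hx
  obtain ⟨y', hy', hdy⟩ := h1 y hy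
  obtain ⟨w, hw, hdw⟩ := h2 _ (hY hx' hy' ha hb hab)
  refine ⟨w, hw, ?_⟩
  have : dist (a • x + b • y) (a • x' + b • y') ≤ ε/3 := by
    rw [dist_eq_norm] at *
    have e : a • x + b • y - (a • x' + b • y') = a • (x - x') + b • (y - y') := by module
    rw [e]
    have := norm_add_le (a • (x - x')) (b • (y - y'))
    rw [norm_smul, norm_smul, Real.norm_of_nonneg ha, Real.norm_of_nonneg hb] at this
    nlinarith
  linarith [dist_triangle (a • x + b • y) (a • x' + b • y') w]

open TopologicalSpace in
/-- class of competitors -/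
def Cls {d : ℕ} (R : ℝ) (m1 m2 c : ℝ≥0∞) :
    Set (NonemptyCompacts (Eu d) × NonemptyCompacts (Eu d)) :=
  {p | Convex ℝ (p.1 : Set (Eu d)) ∧ Convex ℝ (p.2 : Set (Eu d)) ∧
    (p.1 : Set (Eu d)) ⊆ closedBall 0 R ∧ (p.2 : Set (Eu d)) ⊆ closedBall 0 R ∧
    m1 ≤ volume (p.1 : Set (Eu d)) ∧ m2 ≤ volume (p.2 : Set (Eu d)) ∧
    ∀ a ∈ (p.2 : Set (Eu d)), F (p.1 : Set (Eu d)) a ≤ c}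

open TopologicalSpace in
lemma Cls_compact {d : ℕ} (R : ℝ) (m1 m2 c : ℝ≥0∞) : IsCompact (Cls (d := d) R m1 m2 c) := by
  have hC : IsCompact {L : NonemptyCompacts (Eu d) | (L : Set (Eu d)) ⊆ closedBall 0 R} :=
    NonemptyCompacts.isCompact_subsets_of_isCompact (isCompact_closedBall 0 R)
  refine (hC.prod hC).of_isClosed_subset ?_ (fun p hp => ⟨hp.2.2.1, hp.2.2.2.1⟩)
  refine isClosed_of_closure_subset fun p hp => ?_
  have hcl : ∀ ε > 0, ∃ q ∈ Cls (d := d) R m1 m2 c, Near ε (p.1 : Set (Eu d)) q.1 ∧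
      Near ε (q.1 : Set (Eu d)) p.1 ∧ Near ε (p.2 : Set (Eu d)) q.2 ∧
      Near ε (q.2 : Set (Eu d)) p.2 := by
    intro ε hε
    obtain ⟨q, hq, hd⟩ := Metric.mem_closure_iff.1 hp ε hε
    rw [Prod.dist_eq, max_lt_iff] at hd
    refine ⟨q, hq, near_of_dist_lt hd.1, near_of_dist_lt (by rw [dist_comm]; exact hd.1),
      near_of_dist_lt hd.2, near_of_dist_lt (by rw [dist_comm]; exact hd.2)⟩
  have c1 : Convex ℝ (p.1 : Set (Eu d)) := convex_of_near p.1.isCompact.isClosed fun ε hε => by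
    obtain ⟨q, hq, h1, h2, -⟩ := hcl ε hε
    exact ⟨_, hq.1, h1, h2⟩
  have c2 : Convex ℝ (p.2 : Set (Eu d)) := convex_of_near p.2.isCompact.isClosed fun ε hε => by
    obtain ⟨q, hq, -, -, h1, h2⟩ := hcl ε hε
    exact ⟨_, hq.2.1, h1, h2⟩
  have hsub := (hC.prod hC).isClosed.closure_subset_iff.2
    (fun p (hp : p ∈ Cls (d := d) R m1 m2 c) => ⟨hp.2.2.1, hp.2.2.2.1⟩) hp
  refine ⟨c1, c2, hsub.1, hsub.2, ?_, ?_, ?_⟩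
  · have := ((usc_vol (volume : Measure (Eu d))).isClosed_preimage m1).preimage
      (continuous_fst (X := NonemptyCompacts (Eu d)) (Y := NonemptyCompacts (Eu d)))
    exact this.closure_subset_iff.2 (fun p (hp : p ∈ Cls (d := d) R m1 m2 c) => hp.2.2.2.2.1) hp
  · have := ((usc_vol (volume : Measure (Eu d))).isClosed_preimage m2).preimage
      (continuous_snd (X := NonemptyCompacts (Eu d)) (Y := NonemptyCompacts (Eu d)))
    exact this.closure_subset_iff.2 (fun p (hp : p ∈ Cls (d := d) R m1 m2 c) => hp.2.2.2.2.2.1) hp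
  · intro a ha
    refine vol_le_of_near (J_convex _ a) fun ε hε => ?_
    obtain ⟨q, hq, h1, -, h2, -⟩ := hcl (ε/3) (by linarith)
    obtain ⟨b, hb, hd⟩ := h2 a ha
    refine ⟨J q.1 b, (J_compact q.1.isCompact hq.1 b).isClosed, J_convex _ _, ?_,
      hq.2.2.2.2.2.2 b hb⟩
    convert near_J c1 hq.1 h1 hd using 1
    ring

lemma mem_interior_St {d : ℕ} {u : Eu d} (hu : ‖u‖ = 1) {K : Set (Eu d)} {x : Eu d}
    (hx : x ∈ interior K) : x - ⟪u, x⟫ • u ∈ interior (St u K) := by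
  set ξ := ⟪u, x⟫ with hξ
  rw [mem_interior]
  refine ⟨{y | y + ξ • u ∈ interior K} ∩ {y | y + (ξ - 2 * ⟪u, y⟫) • u ∈ interior K}, ?_, ?_, ?_⟩
  · rintro y ⟨h1, h2⟩
    exact (mem_St hu).2 ⟨ξ, interior_subset h1, interior_subset h2⟩
  · exact (isOpen_interior.preimage (by fun_prop)).inter (isOpen_interior.preimage (by fun_prop))
  · have h0 : ⟪u, x - ξ • u⟫ = 0 := by
      rw [inner_sub_right, real_inner_smul_right, real_inner_self_eq_norm_sq, hu]; simp [hξ]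
    constructor
    · simpa using hx
    · simpa [h0] using hx

lemma St_mono {d : ℕ} {u : Eu d} {K K' : Set (Eu d)} (h : K ⊆ K') : St u K ⊆ St u K' :=
  Hf_mono h (image_mono h)

lemma rho_closedBall {d : ℕ} (u : Eu d) (r : ℝ) :
    rho u '' closedBall (0 : Eu d) r = closedBall 0 r := by
  rw [LinearIsometryEquiv.image_closedBall, map_zero]

lemma St_closedBall_subset {d : ℕ} (u : Eu d) (r : ℝ) :
    St u (closedBall (0 : Eu d) r) ⊆ closedBall 0 r := by
  rintro z ⟨t, h1, h2⟩
  rw [rho_closedBall] at h2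
  have := (convex_closedBall (0 : Eu d) r) h1 h2 (a := 1/2) (b := 1/2) (by norm_num) (by norm_num)
    (by norm_num)
  convert this using 1; module

lemma vol_St_inter_ge {n : ℕ} {u : Eu (n+1)} (hu : ‖u‖ = 1) {K : Set (Eu (n+1))}
    (hK : IsCompact K) (hKc : Convex ℝ K) (r : ℝ) :
    volume (K ∩ closedBall 0 r) ≤ volume (St u K ∩ closedBall 0 r) := by
  refine (vol_St_ge hu (hK.inter_right isClosed_closedBall)
    (hKc.inter (convex_closedBall 0 r))).trans (measure_mono (subset_inter ?_ ?_))
  · exact St_mono inter_subset_left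
  · exact (St_mono inter_subset_right).trans (St_closedBall_subset u r)

lemma vol_St_inter_gt {n : ℕ} {K : Set (Eu (n+1))} (hK : IsCompact K) (hKc : Convex ℝ K)
    {r : ℝ} (hr : 0 < r) (hv : volume (closedBall (0 : Eu (n+1)) r) ≤ volume K)
    (hnot : ¬ closedBall (0 : Eu (n+1)) r ⊆ K) :
    ∃ u : Eu (n+1), ‖u‖ = 1 ∧ volume (K ∩ closedBall 0 r) < volume (St u K ∩ closedBall 0 r) := by
  set B := closedBall (0 : Eu (n+1)) r with hB
  have hBi : (interior B).Nonempty := ⟨0, by rw [hB, interior_closedBall _ hr.ne']; simpa using hr⟩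
  have hBc : Convex ℝ B := convex_closedBall _ _
  have hBcl : IsClosed B := isClosed_closedBall
  have hKi : (interior K).Nonempty := by
    rw [nonempty_iff_ne_empty]; intro he
    rw [vol_zero_of_interior_empty hKc he] at hv
    exact (measure_closedBall_pos volume (0 : Eu (n+1)) hr).ne' (le_antisymm hv zero_le)
  have hKB : ¬ K ⊆ B := fun h => hnot
    (subset_of_vol_le hK.isClosed hBc hBi h hv hK.measure_lt_top.ne)
  -- choose interior points
  have ex : ∃ x ∈ interior K, x ∉ B := by
    by_contra! h
    apply hKB
    calc K ⊆ closure K := subset_closure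
      _ = closure (interior K) := (hKc.closure_interior_eq_closure_of_nonempty_interior hKi).symm
      _ ⊆ B := hBcl.closure_subset_iff.2 h
  have ez : ∃ z ∈ interior B, z ∉ K := by
    by_contra! h
    apply hnot
    calc B ⊆ closure B := subset_closure
      _ = closure (interior B) := (hBc.closure_interior_eq_closure_of_nonempty_interior hBi).symm
      _ ⊆ K := hK.isClosed.closure_subset_iff.2 h
  obtain ⟨x, hxK, hxB⟩ := ex
  obtain ⟨z, hzB, hzK⟩ := ez
  have hxz : x ≠ z := fun h => hxB (h ▸ interior_subset hzB)
  have hn : 0 < ‖x - z‖ := norm_pos_iff.2 (sub_ne_zero.2 hxz)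
  set u : Eu (n+1) := ‖x-z‖⁻¹ • (x - z) with hu'
  have hu : ‖u‖ = 1 := by rw [hu', norm_smul, norm_inv, norm_norm, inv_mul_cancel₀ hn.ne']
  have hxu : x = z + ‖x - z‖ • u := by rw [hu', smul_smul, mul_inv_cancel₀ hn.ne']; module
  refine ⟨u, hu, ?_⟩
  set ξ := ⟪u, x⟫ with hξ
  set ζ := ⟪u, z⟫ with hζ
  have huu : ⟪u, u⟫ = 1 := by rw [real_inner_self_eq_norm_sq, hu]; norm_num
  have hξζ : ξ = ζ + ‖x - z‖ := by
    rw [hξ]; conv_lhs => rw [hxu]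
    rw [inner_add_right, real_inner_smul_right, huu, mul_one]
  set p := x - ξ • u with hp
  have hup : ⟪u, p⟫ = 0 := by rw [hp, inner_sub_right, real_inner_smul_right, huu, ← hξ]; ring
  have hxp : x = p + ξ • u := by rw [hp]; module
  have hzp : z = p + ζ • u := by
    have : z = x - ‖x-z‖ • u := by rw [eq_sub_iff_add_eq]; exact hxu.symm
    rw [this, hp, hξζ]; module
  have hBmem : ∀ t : ℝ, p + t • u ∈ B ↔ ‖p‖^2 + t^2 ≤ r^2 := by
    intro t
    rw [hB, mem_closedBall_zero_iff, ← sq_le_sq₀ (norm_nonneg _) hr.le, norm_add_sq_real, norm_smul,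
      hu, real_inner_smul_right, real_inner_comm, hup]
    simp
  have hz2 : ‖p‖^2 + ζ^2 < r^2 := by
    rw [hB, interior_closedBall _ hr.ne', mem_ball_zero_iff, ← sq_lt_sq₀ (norm_nonneg _) hr.le,
      hzp, norm_add_sq_real, norm_smul, hu, real_inner_smul_right, real_inner_comm, hup] at hzB
    simpa using hzB
  have hx2 : ¬ ‖p‖^2 + ξ^2 ≤ r^2 := by rw [← hBmem, ← hxp]; exact hxB
  have hsq0 : 0 < r^2 - ‖p‖^2 := by nlinarith [sq_nonneg ζ]
  set h := Real.sqrt (r^2 - ‖p‖^2) with hh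
  have h0 : 0 < h := Real.sqrt_pos.2 hsq0
  have hsq : h^2 = r^2 - ‖p‖^2 := Real.sq_sqrt hsq0.le
  have hI : ∀ t : ℝ, p + t • u ∈ B ↔ t ∈ Icc (-h) h := by
    intro t
    rw [hBmem, mem_Icc, ← abs_le, ← sq_le_sq₀ (abs_nonneg _) h0.le, sq_abs, hsq]
    constructor <;> intro <;> linarith
  have hζI : ζ ∈ Icc (-h) h := by rw [← hI, ← hzp]; exact interior_subset hzB
  have hξI : h < ξ := by
    by_contra hc
    apply hxB; rw [hxp, hI]
    exact ⟨by linarith [hζI.1], not_lt.1 hc⟩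
  rcases fiber_Icc hu hK hKc p with he | ⟨a, b, hab, hKI⟩
  · exfalso
    have : ξ ∈ {t : ℝ | p + t • u ∈ K} := by
      change p + ξ • u ∈ K; rw [← hxp]; exact interior_subset hxK
    rw [he] at this; exact this
  have hKI' : ∀ t : ℝ, p + t • u ∈ K ↔ t ∈ Icc a b := fun t => by rw [← hKI]; rfl
  have hξK : ξ ∈ Icc a b := by rw [← hKI', ← hxp]; exact interior_subset hxK
  have hζa : ζ < a := by
    by_contra hc
    apply hzK; rw [hzp, hKI']
    exact ⟨not_lt.1 hc, by linarith [hξK.2]⟩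
  by_contra hcon
  push Not at hcon
  have hcomp : IsCompact (K ∩ B) := hK.inter_right hBcl
  have hconv : Convex ℝ (K ∩ B) := hKc.inter hBc
  have hpint : p ∈ interior (St u K ∩ B) := by
    rw [interior_inter]
    refine ⟨mem_interior_St hu hxK, ?_⟩
    rw [hB, interior_closedBall _ hr.ne', mem_ball_zero_iff, ← sq_lt_sq₀ (norm_nonneg _) hr.le]
    nlinarith [sq_nonneg ζ]
  have hsub := subset_of_vol_le (St_compact (u := u) hcomp).isClosed ((St_convex hKc).inter hBc)
    ⟨p, hpint⟩ (subset_inter (St_mono inter_subset_left)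
      ((St_mono inter_subset_right).trans (St_closedBall_subset u r)))
    (hcon.trans (vol_St_ge hu hcomp hconv)) (St_compact hcomp).measure_lt_top.ne
  set t := min ((b-a)/2) h with ht
  have ht1 : t ≤ (b-a)/2 := min_le_left _ _
  have ht2 : t ≤ h := min_le_right _ _
  have ht0 : 0 ≤ t := le_min (by linarith) h0.le
  have ht3 : h - a < 2 * t := by
    rcases min_choice ((b-a)/2) h with h1 | h1 <;> rw [ht, h1]
    · linarith [hξK.2]
    · linarith [hζI.1]
  have hut : ⟪u, p + t • u⟫ = t := by
    rw [inner_add_right, hup, real_inner_smul_right, huu]; ring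
  have hwmem : p + t • u ∈ St u K ∩ B := by
    refine ⟨(mem_St hu).2 ⟨(a+b)/2, ?_, ?_⟩, (hI t).2 ⟨by linarith, ht2⟩⟩
    · rw [add_assoc, ← add_smul, hKI']; constructor <;> linarith
    · rw [hut, add_assoc, ← add_smul, hKI']; constructor <;> linarith
  obtain ⟨s, hs1, hs2⟩ := (mem_St hu).1 (hsub hwmem)
  rw [hut, add_assoc, ← add_smul] at hs2
  rw [add_assoc, ← add_smul] at hs1
  have g1 := ((hI _).1 hs1.2).2
  have g2 := ((hKI' _).1 hs2.1).1
  linarith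

open TopologicalSpace in
theorem thmA {n : ℕ} {K L : Set (Eu (n+1))} (hK : IsCompact K) (hKc : Convex ℝ K)
    (hL : IsCompact L) (hLc : Convex ℝ L) {c : ℝ≥0∞}
    (hF : ∀ a ∈ L, F K a ≤ c) {r1 r2 : ℝ} (hr1 : 0 < r1) (hr2 : 0 < r2)
    (hv1 : volume (closedBall (0 : Eu (n+1)) r1) ≤ volume K)
    (hv2 : volume (closedBall (0 : Eu (n+1)) r2) ≤ volume L) :
    ∀ a ∈ closedBall (0 : Eu (n+1)) r2, F (closedBall 0 r1) a ≤ c := by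
  set m1 := volume (closedBall (0 : Eu (n+1)) r1)
  set m2 := volume (closedBall (0 : Eu (n+1)) r2)
  have hm1 : 0 < m1 := measure_closedBall_pos _ _ hr1
  have hm2 : 0 < m2 := measure_closedBall_pos _ _ hr2
  have hne : ∀ X : Set (Eu (n+1)), 0 < volume X → X.Nonempty := fun X h => by
    rw [nonempty_iff_ne_empty]; rintro rfl; simp at h
  obtain ⟨R1, hR1⟩ := hK.isBounded.subset_closedBall 0
  obtain ⟨R2, hR2⟩ := hL.isBounded.subset_closedBall 0
  set R := max R1 R2
  let p0 : NonemptyCompacts (Eu (n+1)) × NonemptyCompacts (Eu (n+1)) :=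
    (⟨⟨K, hK⟩, hne K (hm1.trans_le hv1)⟩, ⟨⟨L, hL⟩, hne L (hm2.trans_le hv2)⟩)
  have hp0 : p0 ∈ Cls R m1 m2 c :=
    ⟨hKc, hLc, hR1.trans (closedBall_subset_closedBall (le_max_left _ _)),
      hR2.trans (closedBall_subset_closedBall (le_max_right _ _)), hv1, hv2, hF⟩
  let μ1 := (volume : Measure (Eu (n+1))).restrict (closedBall 0 r1)
  let μ2 := (volume : Measure (Eu (n+1))).restrict (closedBall 0 r2)
  let φ : NonemptyCompacts (Eu (n+1)) × NonemptyCompacts (Eu (n+1)) → ℝ≥0∞ :=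
    fun p => μ1 (p.1 : Set (Eu (n+1))) + μ2 (p.2 : Set (Eu (n+1)))
  have hφ : UpperSemicontinuous φ := by
    refine UpperSemicontinuous.add ?_ ?_
    · exact (usc_vol μ1).comp continuous_fst
    · exact (usc_vol μ2).comp continuous_snd
  obtain ⟨p, hp, hmax⟩ := (hφ.upperSemicontinuousOn _).exists_isMaxOn ⟨p0, hp0⟩
    (Cls_compact R m1 m2 c)
  obtain ⟨c1, c2, s1, s2, w1, w2, hFp⟩ := hp
  have e1 : ∀ X : NonemptyCompacts (Eu (n+1)), μ1 (X : Set (Eu (n+1))) =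
      volume ((X : Set (Eu (n+1))) ∩ closedBall 0 r1) := fun X =>
    Measure.restrict_apply X.isCompact.measurableSet
  have e2 : ∀ X : NonemptyCompacts (Eu (n+1)), μ2 (X : Set (Eu (n+1))) =
      volume ((X : Set (Eu (n+1))) ∩ closedBall 0 r2) := fun X =>
    Measure.restrict_apply X.isCompact.measurableSet
  -- symmetrization of the maximizer stays in the class
  have hstep : ∀ u : Eu (n+1), ‖u‖ = 1 →
      volume (St u (p.1 : Set (Eu (n+1))) ∩ closedBall 0 r1) +
        volume (St u (p.2 : Set (Eu (n+1))) ∩ closedBall 0 r2) ≤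
      volume ((p.1 : Set (Eu (n+1))) ∩ closedBall 0 r1) +
        volume ((p.2 : Set (Eu (n+1))) ∩ closedBall 0 r2) := by
    intro u hu
    have v1 := vol_St_ge hu p.1.isCompact c1
    have v2 := vol_St_ge hu p.2.isCompact c2
    let q : NonemptyCompacts (Eu (n+1)) × NonemptyCompacts (Eu (n+1)) :=
      (⟨⟨St u p.1, St_compact p.1.isCompact⟩, hne _ ((hm1.trans_le w1).trans_le v1)⟩,
        ⟨⟨St u p.2, St_compact p.2.isCompact⟩, hne _ ((hm2.trans_le w2).trans_le v2)⟩)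
    have hq : q ∈ Cls R m1 m2 c :=
      ⟨St_convex c1, St_convex c2, (St_mono s1).trans (St_closedBall_subset u R),
        (St_mono s2).trans (St_closedBall_subset u R), w1.trans v1, w2.trans v2,
        F_St_le hu p.1.isCompact c1 hFp⟩
    have h := hmax hq
    change φ q ≤ φ p at h
    simp only [φ, e1, e2] at h
    exact h
  have fin1 : ∀ (X : Set (Eu (n+1))) (r : ℝ), volume (X ∩ closedBall 0 r) ≠ ∞ := fun X r =>
    ((measure_mono inter_subset_right).trans_lt (isCompact_closedBall 0 r).measure_lt_top).ne
  have b1 : closedBall (0 : Eu (n+1)) r1 ⊆ p.1 := by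
    by_contra hnot
    obtain ⟨u, hu, hlt⟩ := vol_St_inter_gt p.1.isCompact c1 hr1 w1 hnot
    have h2 := vol_St_inter_ge hu p.2.isCompact c2 r2
    exact absurd (hstep u hu) (not_le.2 (ENNReal.add_lt_add_of_lt_of_le (fin1 _ _) hlt h2))
  have b2 : closedBall (0 : Eu (n+1)) r2 ⊆ p.2 := by
    by_contra hnot
    obtain ⟨u, hu, hlt⟩ := vol_St_inter_gt p.2.isCompact c2 hr2 w2 hnot
    have h2 := vol_St_inter_ge hu p.1.isCompact c1 r1
    exact absurd (hstep u hu) (not_le.2 (ENNReal.add_lt_add_of_le_of_lt (fin1 _ _) h2 hlt))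
  intro a ha
  exact (F_mono b1 a).trans (hFp a (b2 ha))

/-- the constant of the theorem -/
noncomputable def kap (n : ℕ) : ℝ≥0∞ :=
  ENNReal.ofReal (1 + 2 * unitBallVol n / unitBallVol (n+1))

lemma unitBallVol_pos (n : ℕ) : 0 < unitBallVol n :=
  ENNReal.toReal_pos (measure_closedBall_pos _ _ one_pos).ne'
    (isCompact_closedBall _ _).measure_lt_top.ne

lemma vol_ball (n : ℕ) {r : ℝ} (hr : 0 ≤ r) :
    volume (closedBall (0 : Eu n) r) = ENNReal.ofReal (r^n * unitBallVol n) := by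
  rw [Measure.addHaar_closedBall' _ _ hr, ENNReal.ofReal_mul (by positivity), unitBallVol,
    ENNReal.ofReal_toReal (isCompact_closedBall _ _).measure_lt_top.ne]
  simp

lemma F_ball' {n : ℕ} {r : ℝ} (hr : 0 ≤ r) (a : Eu (n+1)) :
    F (closedBall (0 : Eu (n+1)) r) a =
      ENNReal.ofReal (r^(n+1) * unitBallVol (n+1) + 2 * ‖a‖ * (r^n * unitBallVol n)) := by
  have := (unitBallVol_pos n).le
  have := (unitBallVol_pos (n+1)).le
  rw [F_ball hr, vol_ball _ hr, vol_ball _ hr, ← ENNReal.ofReal_mul (by positivity),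
    ← ENNReal.ofReal_add (by positivity) (by positivity)]

lemma kap_ball {n : ℕ} {r : ℝ} (hr : 0 ≤ r) :
    kap n * volume (closedBall (0 : Eu (n+1)) r) =
      ENNReal.ofReal (r^(n+1) * unitBallVol (n+1) + 2 * r * (r^n * unitBallVol n)) := by
  have := (unitBallVol_pos n).le
  have h2 := (unitBallVol_pos (n+1))
  rw [kap, vol_ball _ hr, ← ENNReal.ofReal_mul (by positivity)]
  congr 1
  field_simp
  ring

lemma exists_radius {n : ℕ} {m : ℝ≥0∞} (h0 : m ≠ 0) (ht : m ≠ ∞) :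
    ∃ r : ℝ, 0 < r ∧ volume (closedBall (0 : Eu (n+1)) r) = m := by
  have hv := unitBallVol_pos (n+1)
  have hm : 0 < m.toReal := ENNReal.toReal_pos h0 ht
  have hq : 0 < m.toReal / unitBallVol (n+1) := div_pos hm hv
  refine ⟨(m.toReal / unitBallVol (n+1)) ^ (((n+1 : ℕ) : ℝ)⁻¹), Real.rpow_pos_of_pos hq _, ?_⟩
  rw [vol_ball _ (Real.rpow_nonneg hq.le _), Real.rpow_inv_natCast_pow hq.le (Nat.succ_ne_zero n),
    div_mul_cancel₀ _ hv.ne', ENNReal.ofReal_toReal ht]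

lemma vol_pos_of_interior {d : ℕ} {K : Set (Eu d)} (h : (interior K).Nonempty) : volume K ≠ 0 :=
  (Measure.measure_pos_of_nonempty_interior volume h).ne'

lemma exists_norm_eqq {n : ℕ} {r : ℝ} (hr : 0 ≤ r) : ∃ a : Eu (n+1), ‖a‖ = r :=
  ⟨EuclideanSpace.single 0 r, by simp [abs_of_nonneg hr]⟩

theorem main_ineq {n : ℕ} {K : Set (Eu (n+1))} (hK : IsCompact K) (hKc : Convex ℝ K)
    (hKi : (interior K).Nonempty) {c : ℝ≥0∞} (h : ∀ a ∈ K, F K a ≤ c) :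
    kap n * volume K ≤ c := by
  obtain ⟨r, hr, hv⟩ := exists_radius (n := n) (vol_pos_of_interior hKi) hK.measure_lt_top.ne
  obtain ⟨a, ha⟩ := exists_norm_eqq (n := n) hr.le
  have := thmA hK hKc hK hKc h hr hr hv.le hv.le a (by simp [ha])
  rwa [F_ball' hr.le, ha, ← kap_ball hr.le, hv] at this

lemma F_lt_nhds {d : ℕ} {K : Set (Eu d)} (hK : IsCompact K) (hKc : Convex ℝ K) {a : Eu d}
    {c : ℝ≥0∞} (h : F K a < c) : ∀ᶠ b in 𝓝 a, F K b < c := by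
  have ht := (tendsto_measure_cthickening_of_isCompact (μ := volume)
    (J_compact hK hKc a)).eventually_lt_const h
  obtain ⟨ε, hε, hb⟩ := Metric.eventually_nhds_iff.1 ht
  have hε2 : volume (cthickening (ε/2) (J K a)) < c := hb (by
    rw [Real.dist_eq, sub_zero, abs_of_pos (by linarith)]; linarith)
  rw [Metric.eventually_nhds_iff]
  refine ⟨ε/4, by linarith, fun b hb => lt_of_le_of_lt (measure_mono ?_) hε2⟩
  intro z hz
  obtain ⟨w, hw, hd⟩ := near_J hKc hKc (near_refl K) hb.le z hz
  exact mem_cthickening_of_dist_le z w _ _ hw (by linarith)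

/-- extremal bodies -/
structure Extremal {n : ℕ} (K : Set (Eu (n+1))) : Prop where
  compact : IsCompact K
  convex : Convex ℝ K
  int : (interior K).Nonempty
  le : ∀ a ∈ K, F K a ≤ kap n * volume K

lemma Extremal.bdry {n : ℕ} {K : Set (Eu (n+1))} (hE : Extremal K) {a : Eu (n+1)} (ha : a ∈ K)
    (hai : a ∉ interior K) : F K a = kap n * volume K := by
  obtain ⟨hK, hKc, hKi, hle⟩ := hE
  refine le_antisymm (hle a ha) (not_lt.1 fun hlt => ?_)
  set c := kap n * volume K with hc
  obtain ⟨R, hR⟩ := hK.isBounded.subset_closedBall 0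
  set L := {b | F K b ≤ c} ∩ closedBall 0 (R+1) with hL
  have hLcomp : IsCompact L := (isCompact_closedBall 0 (R+1)).inter_left (F_closed hK hKc c)
  have hLconv : Convex ℝ L := (F_convex hK hKc c).inter (convex_closedBall _ _)
  have hKL : K ⊆ L := fun x hx =>
    ⟨hle x hx, closedBall_subset_closedBall (by linarith) (hR hx)⟩
  have hvol : volume K < volume L := by
    refine not_le.1 fun hv => hai ?_
    have := subset_of_vol_le hK.isClosed hLconv (hKi.mono (interior_mono hKL)) hKL hv
      hK.measure_lt_top.ne
    refine interior_mono this ?_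
    rw [mem_interior_iff_mem_nhds]
    refine inter_mem ?_ ?_
    · filter_upwards [F_lt_nhds hK hKc hlt] with b hb using hb.le
    · refine mem_of_superset (isOpen_ball.mem_nhds (x := a) (s := ball 0 (R+1)) ?_) ball_subset_closedBall
      have := hR ha
      rw [mem_closedBall] at this; rw [mem_ball]; linarith
  obtain ⟨r1, hr1, hv1⟩ := exists_radius (n := n) (vol_pos_of_interior hKi) hK.measure_lt_top.ne
  obtain ⟨r2, hr2, hv2⟩ := exists_radius (n := n) (m := volume L)
    (zero_le.trans_lt hvol).ne' hLcomp.measure_lt_top.ne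
  obtain ⟨b, hb⟩ := exists_norm_eqq (n := n) hr2.le
  have := thmA hK hKc hLcomp hLconv (fun x hx => hx.1) hr1 hr2 hv1.le hv2.le b (by simp [hb])
  have p1 := unitBallVol_pos n
  have p2 := unitBallVol_pos (n+1)
  rw [F_ball' hr1.le, hb, hc, ← hv1, kap_ball hr1.le,
    ENNReal.ofReal_le_ofReal_iff (by positivity)] at this
  have h3 : r2 ≤ r1 := by
    by_contra h
    push Not at h
    have : r1 * (r1^n * unitBallVol n) < r2 * (r1^n * unitBallVol n) :=
      mul_lt_mul_of_pos_right h (by positivity)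
    linarith
  rw [← hv1, ← hv2] at hvol
  exact absurd (measure_mono (closedBall_subset_closedBall h3)) (not_le.2 hvol)

lemma Extremal.St {n : ℕ} {K : Set (Eu (n+1))} (hE : Extremal K) {u : Eu (n+1)} (hu : ‖u‖ = 1) :
    Extremal (St u K) := by
  obtain ⟨hK, hKc, ⟨x, hx⟩, hle⟩ := hE
  refine ⟨St_compact hK, St_convex hKc, ⟨_, mem_interior_St hu hx⟩, ?_⟩
  exact F_St_le hu hK hKc fun a ha => (hle a ha).trans (mul_le_mul_right (vol_St_ge hu hK hKc) _)

lemma Extremal.translate {n : ℕ} {K : Set (Eu (n+1))} (hE : Extremal K) (z : Eu (n+1)) :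
    Extremal ((fun x => z + x) '' K) := by
  obtain ⟨hK, hKc, hi, hle⟩ := hE
  refine ⟨hK.image (by fun_prop), hKc.translate z, ?_, ?_⟩
  · have := (Homeomorph.addLeft z).image_interior K
    change (interior (Homeomorph.addLeft z '' K)).Nonempty
    rw [← this]; exact hi.image _
  · rintro _ ⟨a, ha, rfl⟩
    rw [F_translate]
    refine (hle a ha).trans (le_of_eq ?_)
    rw [image_add_left, measure_preimage_add]

lemma vol_rho {d : ℕ} (u : Eu d) (K : Set (Eu d)) : volume (rho u '' K) = volume K := by
  rw [← (rho u).measurePreserving.measure_preimage_equiv (f := (rho u).toHomeomorph.toMeasurableEquiv)]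
  congr 1
  exact preimage_image_eq _ (rho u).injective

lemma Extremal.rho {n : ℕ} {K : Set (Eu (n+1))} (hE : Extremal K) (u : Eu (n+1)) :
    Extremal (rho u '' K) := by
  obtain ⟨hK, hKc, hi, hle⟩ := hE
  refine ⟨rho_image_compact hK, rho_image_convex hKc, ?_, ?_⟩
  · have := (_root_.rho u).toHomeomorph.image_interior K
    change (interior ((_root_.rho u).toHomeomorph '' K)).Nonempty
    rw [← this]; exact hi.image _
  · rintro _ ⟨a, ha, rfl⟩
    rw [F_rho, vol_rho]
    exact hle a ha

/-- the point over `x` (along direction `u`) at height `h` -/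
noncomputable def Pt {d : ℕ} (u x : Eu d) (h : ℝ) : Eu d := x + (h - ⟪u, x⟫) • u

section pts
variable {d : ℕ} {u : Eu d}

lemma inner_self_unit (hu : ‖u‖ = 1) : ⟪u, u⟫ = (1:ℝ) := by
  rw [real_inner_self_eq_norm_sq, hu]; norm_num

lemma inner_Pt (hu : ‖u‖ = 1) (x : Eu d) (h : ℝ) : ⟪u, Pt u x h⟫ = h := by
  simp only [Pt, inner_add_right, inner_smul_right, inner_self_unit hu]; ring

lemma Pt_Pt (hu : ‖u‖ = 1) (x : Eu d) (h k : ℝ) : Pt u (Pt u x h) k = Pt u x k := by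
  rw [Pt, inner_Pt hu, Pt, Pt]; module

lemma Pt_self (x : Eu d) : Pt u x ⟪u, x⟫ = x := by simp [Pt]

lemma Pt_comb (x y : Eu d) (h k α β : ℝ) :
    Pt u (α • x + β • y) (α * h + β * k) = α • Pt u x h + β • Pt u y k := by
  simp only [Pt, inner_add_right, inner_smul_right]; module

lemma Pt_neg (x : Eu d) (h : ℝ) : Pt u (-x) (-h) = - Pt u x h := by
  simp only [Pt, inner_neg_right]; module

lemma Pt_add_smul (x : Eu d) (h s : ℝ) : Pt u x h + s • u = Pt u x (h + s) := by
  simp only [Pt]; module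

lemma Pt_sub (x a : Eu d) (h s : ℝ) : Pt u x h - s • a = Pt u (x - s • a) (h - s * ⟪u, a⟫) := by
  simp only [Pt, inner_sub_right, inner_smul_right]; module

lemma rho_Pt (hu : ‖u‖ = 1) (x : Eu d) (h : ℝ) : rho u (Pt u x h) = Pt u x (-h) := by
  rw [rho_apply hu, inner_Pt hu]; simp only [Pt]; module

lemma Pt_mem_rho (hu : ‖u‖ = 1) {K : Set (Eu d)} (x : Eu d) (h : ℝ) :
    Pt u x h ∈ rho u '' K ↔ Pt u x (-h) ∈ K := by
  rw [mem_rho_image, rho_Pt hu]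

lemma Pt_add_u (hu : ‖u‖ = 1) (x : Eu d) (s h : ℝ) : Pt u (x + s • u) h = Pt u x h := by
  simp only [Pt, inner_add_right, inner_smul_right, inner_self_unit hu]; module

lemma Pt_continuous (u : Eu d) : Continuous fun p : Eu d × ℝ => Pt u p.1 p.2 := by
  unfold Pt; fun_prop

/-- shadow -/
def Om (u : Eu d) (K : Set (Eu d)) : Set (Eu d) := {x | ∃ h, Pt u x h ∈ K}

/-- top height -/
noncomputable def Gt (u : Eu d) (K : Set (Eu d)) (x : Eu d) : ℝ := sSup {h | Pt u x h ∈ K}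

/-- half-length -/
noncomputable def Ll (u : Eu d) (K : Set (Eu d)) (x : Eu d) : ℝ :=
  (Gt u K x + Gt u (rho u '' K) x) / 2

/-- mid height -/
noncomputable def Mu (u : Eu d) (K : Set (Eu d)) (x : Eu d) : ℝ :=
  (Gt u K x - Gt u (rho u '' K) x) / 2

lemma rho_rho_image (u : Eu d) (K : Set (Eu d)) : rho u '' (rho u '' K) = K := by
  ext x; rw [mem_rho_image, mem_rho_image, rho_rho]

lemma Ll_rho (K : Set (Eu d)) (x : Eu d) : Ll u (rho u '' K) x = Ll u K x := by
  simp only [Ll, rho_rho_image]; ring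

lemma Mu_rho (K : Set (Eu d)) (x : Eu d) : Mu u (rho u '' K) x = - Mu u K x := by
  simp only [Mu, rho_rho_image]; ring

lemma Om_rho (hu : ‖u‖ = 1) (K : Set (Eu d)) : Om u (rho u '' K) = Om u K := by
  ext x
  simp only [Om, mem_setOf_eq, Pt_mem_rho hu]
  exact ⟨fun ⟨h, hh⟩ => ⟨_, hh⟩, fun ⟨h, hh⟩ => ⟨-h, by simpa using hh⟩⟩

lemma hts_compact (hu : ‖u‖ = 1) {K : Set (Eu d)} (hK : IsCompact K) (x : Eu d) :
    IsCompact {h | Pt u x h ∈ K} := by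
  obtain ⟨R, hR⟩ := hK.isBounded.subset_closedBall 0
  refine (isCompact_Icc (a := -R) (b := R)).of_isClosed_subset ?_ ?_
  · exact hK.isClosed.preimage ((Pt_continuous u).comp (by fun_prop : Continuous fun h : ℝ => (x, h)))
  · intro h hh
    have h1 : ‖Pt u x h‖ ≤ R := by simpa using hR hh
    have h2 := abs_real_inner_le_norm u (Pt u x h)
    rw [inner_Pt hu, hu, one_mul] at h2
    exact abs_le.1 (h2.trans h1)

lemma Gt_mem (hu : ‖u‖ = 1) {K : Set (Eu d)} (hK : IsCompact K) {x : Eu d} (hx : x ∈ Om u K) :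
    Pt u x (Gt u K x) ∈ K := (hts_compact hu hK x).sSup_mem hx

lemma le_Gt (hu : ‖u‖ = 1) {K : Set (Eu d)} (hK : IsCompact K) {x : Eu d} {h : ℝ}
    (hx : Pt u x h ∈ K) : h ≤ Gt u K x := le_csSup (hts_compact hu hK x).bddAbove hx

lemma bot_mem (hu : ‖u‖ = 1) {K : Set (Eu d)} (hK : IsCompact K) {x : Eu d} (hx : x ∈ Om u K) :
    Pt u x (-Gt u (rho u '' K) x) ∈ K := by
  rw [← Pt_mem_rho hu]
  exact Gt_mem hu (rho_image_compact hK) (by rwa [Om_rho hu])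

lemma neg_Gt_le (hu : ‖u‖ = 1) {K : Set (Eu d)} (hK : IsCompact K) {x : Eu d} {h : ℝ}
    (hx : Pt u x h ∈ K) : -Gt u (rho u '' K) x ≤ h := by
  have := le_Gt (h := -h) (x := x) hu (rho_image_compact (u := u) hK) (by rw [Pt_mem_rho hu]; simpa)
  linarith

lemma Pt_mem_iff (hu : ‖u‖ = 1) {K : Set (Eu d)} (hK : IsCompact K) (hKc : Convex ℝ K) {x : Eu d}
    {h : ℝ} : Pt u x h ∈ K ↔ x ∈ Om u K ∧ -Gt u (rho u '' K) x ≤ h ∧ h ≤ Gt u K x := by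
  refine ⟨fun hx => ⟨⟨h, hx⟩, neg_Gt_le hu hK hx, le_Gt hu hK hx⟩, fun ⟨hx, h1, h2⟩ => ?_⟩
  have hcv : Convex ℝ {h | Pt u x h ∈ K} := by
    intro h1 hh1 h2 hh2 a b ha hb hab
    have := hKc hh1 hh2 ha hb hab
    rw [← Pt_comb, ← add_smul, hab, one_smul] at this
    exact this
  exact hcv.ordConnected.out (bot_mem hu hK hx) (Gt_mem hu hK hx) ⟨h1, h2⟩

lemma Om_convex {K : Set (Eu d)} (hKc : Convex ℝ K) : Convex ℝ (Om u K) := by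
  rintro x ⟨h, hx⟩ y ⟨k, hy⟩ a b ha hb hab
  exact ⟨a * h + b * k, by rw [Pt_comb]; exact hKc hx hy ha hb hab⟩

lemma Gt_concave (hu : ‖u‖ = 1) {K : Set (Eu d)} (hK : IsCompact K) (hKc : Convex ℝ K) :
    ConcaveOn ℝ (Om u K) (Gt u K) := by
  refine ⟨Om_convex hKc, ?_⟩
  intro x hx y hy a b ha hb hab
  refine le_Gt hu hK ?_
  rw [smul_eq_mul, smul_eq_mul, Pt_comb]
  exact hKc (Gt_mem hu hK hx) (Gt_mem hu hK hy) ha hb hab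

lemma Ll_concave (hu : ‖u‖ = 1) {K : Set (Eu d)} (hK : IsCompact K) (hKc : Convex ℝ K) :
    ConcaveOn ℝ (Om u K) (Ll u K) := by
  have h1 := Gt_concave hu hK hKc
  have h2 := Gt_concave hu (rho_image_compact (u := u) hK) (rho_image_convex hKc)
  rw [Om_rho hu] at h2
  refine ((h1.add h2).smul (c := (1/2 : ℝ)) (by norm_num)).congr ?_
  intro x _
  simp [Ll]; ring

lemma mem_St_iff (hu : ‖u‖ = 1) {K : Set (Eu d)} (hK : IsCompact K) (hKc : Convex ℝ K) {x : Eu d}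
    {h : ℝ} : Pt u x h ∈ St u K ↔ x ∈ Om u K ∧ |h| ≤ Ll u K x := by
  rw [mem_St hu]
  simp only [inner_Pt hu, Pt_add_smul]
  simp only [Pt_mem_iff hu hK hKc, Ll, abs_le]
  constructor
  · rintro ⟨t, ⟨h1, h2, h3⟩, _, h4, h5⟩
    exact ⟨h1, by linarith, by linarith⟩
  · rintro ⟨h1, h2, h3⟩
    exact ⟨Mu u K x, ⟨h1, by simp only [Mu]; linarith, by simp only [Mu]; linarith⟩, h1,
      by simp only [Mu]; linarith, by simp only [Mu]; linarith⟩

lemma St_rho (hu : ‖u‖ = 1) (K : Set (Eu d)) : St u (rho u '' K) = St u K := by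
  ext z
  rw [mem_St hu, mem_St hu]
  have : ∀ t, z + t • u = Pt u z (⟪u,z⟫ + t) := fun t => by simp [Pt]
  simp only [this, Pt_mem_rho hu]
  constructor <;> rintro ⟨t, h1, h2⟩ <;> refine ⟨2 * ⟪u,z⟫-2*⟪u,z⟫ - t, ?_, ?_⟩
  · convert h2 using 2; ring
  · convert h1 using 2; ring
  · convert h2 using 2; ring
  · convert h1 using 2; ring

lemma St_rho_inv (hu : ‖u‖ = 1) {K : Set (Eu d)} {x : Eu d} (hx : x ∈ St u K) :
    rho u x ∈ St u K := by
  rw [mem_St hu] at hx ⊢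
  obtain ⟨t, h1, h2⟩ := hx
  refine ⟨t, ?_, ?_⟩
  · convert h2 using 1; rw [rho_apply hu]; module
  · convert h1 using 1; rw [rho_apply hu]
    simp only [inner_sub_right, inner_smul_right, inner_self_unit hu]; module

lemma Gt_inv (hu : ‖u‖ = 1) (K : Set (Eu d)) (x : Eu d) (s : ℝ) :
    Gt u K (x + s • u) = Gt u K x := by simp only [Gt, Pt_add_u hu]

lemma Ll_inv (hu : ‖u‖ = 1) (K : Set (Eu d)) (x : Eu d) (s : ℝ) :
    Ll u K (x + s • u) = Ll u K x := by simp only [Ll, Gt_inv hu]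

lemma Mu_inv (hu : ‖u‖ = 1) (K : Set (Eu d)) (x : Eu d) (s : ℝ) :
    Mu u K (x + s • u) = Mu u K x := by simp only [Mu, Gt_inv hu]

lemma Om_inv (hu : ‖u‖ = 1) (K : Set (Eu d)) (x : Eu d) (s : ℝ) :
    x + s • u ∈ Om u K ↔ x ∈ Om u K := by simp only [Om, mem_setOf_eq, Pt_add_u hu]

lemma Ll_nonneg (hu : ‖u‖ = 1) {K : Set (Eu d)} (hK : IsCompact K) {x : Eu d} (hx : x ∈ Om u K) :
    0 ≤ Ll u K x := by
  have := le_Gt hu hK (bot_mem hu hK hx)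
  unfold Ll; linarith

lemma Om_neg (hu : ‖u‖ = 1) {K : Set (Eu d)} (hK : IsCompact K) (hKc : Convex ℝ K)
    (hs : ∀ x ∈ St u K, -x ∈ St u K) {x : Eu d} (hx : x ∈ Om u K) : -x ∈ Om u K := by
  have h1 : Pt u x 0 ∈ St u K := (mem_St_iff hu hK hKc).2 ⟨hx, by simpa using Ll_nonneg hu hK hx⟩
  have := hs _ h1
  rw [← Pt_neg] at this
  exact ((mem_St_iff hu hK hKc).1 this).1

lemma Ll_neg (hu : ‖u‖ = 1) {K : Set (Eu d)} (hK : IsCompact K) (hKc : Convex ℝ K)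
    (hs : ∀ x ∈ St u K, -x ∈ St u K) {x : Eu d} (hx : x ∈ Om u K) : Ll u K (-x) = Ll u K x := by
  have key : ∀ x ∈ Om u K, Ll u K x ≤ Ll u K (-x) := by
    intro x hx
    have h1 : Pt u x (Ll u K x) ∈ St u K :=
      (mem_St_iff hu hK hKc).2 ⟨hx, (abs_of_nonneg (Ll_nonneg hu hK hx)).le⟩
    have := hs _ h1
    rw [← Pt_neg] at this
    have := ((mem_St_iff hu hK hKc).1 this).2
    rw [abs_neg] at this
    exact (le_abs_self _).trans this
  have h2 := key _ (Om_neg hu hK hKc hs hx)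
  rw [neg_neg] at h2
  exact le_antisymm h2 (key x hx)

end pts

lemma key_plus {n : ℕ} {u : Eu (n+1)} (hu : ‖u‖ = 1) {K : Set (Eu (n+1))} (hE : Extremal K)
    (hs : ∀ x ∈ St u K, -x ∈ St u K) {a p : Eu (n+1)} (ha : a ∈ St u K)
    (hai : a ∉ interior (St u K)) (hp : p ∈ Om u K)
    (hc : ∀ s : ℝ, 0 ≤ s → p - s • a ∈ Om u K → Ll u K (p - s • a) ≤ Ll u K p - s * ⟪u, a⟫)
    {ε : ℝ} (hε : 0 < ε) (hx : p - (2*ε) • a ∈ Om u K) :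
    Mu u K (p - (2*ε) • a) - Mu u K p + ε * (2 * Mu u K a - Mu u K p - Mu u K (-p)) ≤
      Ll u K p - Ll u K (p - (2*ε) • a) - 2 * ε * ⟪u, a⟫ := by
  have hE' := hE.rho u
  have hE0 := hE.St hu
  have hK := hE.compact
  have hKc := hE.convex
  set K0 := St u K with hK0
  set K' := rho u '' K with hK'
  set t := Mu u K a with ht
  have haP : Pt u a ⟪u, a⟫ = a := Pt_self a
  have haO : a ∈ Om u K ∧ |⟪u,a⟫| ≤ Ll u K a := by
    rw [← mem_St_iff hu hK hKc, haP]; exact ha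
  obtain ⟨haO, hal⟩ := haO
  have hal' := abs_le.1 hal
  have hap : a + t • u = Pt u a (⟪u,a⟫ + t) := by rw [← Pt_add_smul, haP]
  have ham : a - t • u = Pt u a (⟪u,a⟫ - t) := by
    rw [sub_eq_add_neg, ← neg_smul, sub_eq_add_neg ⟪u,a⟫, ← Pt_add_smul, haP]
  have hapK : a + t • u ∈ K := by
    rw [hap, Pt_mem_iff hu hK hKc]
    refine ⟨haO, ?_, ?_⟩ <;> simp only [ht, Mu, Ll] at hal' ⊢ <;> linarith
  have hamK : a - t • u ∈ K' := by
    rw [ham, hK', Pt_mem_rho hu, Pt_mem_iff hu hK hKc]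
    refine ⟨haO, ?_, ?_⟩ <;> simp only [ht, Mu, Ll] at hal' ⊢ <;> linarith
  have hsub : J K0 a ⊆ Hf u (J K (a + t • u)) (J K' (a - t • u)) :=
    J_Hf hKc (rho_image_convex hKc) a t
  have hv : volume (Hf u (J K (a + t • u)) (J K' (a - t • u))) ≤ volume (J K0 a) := by
    have h1 := vol_Hf_le hu (J_compact hK hKc (a + t • u)) (J_convex K (a + t • u))
      (J_compact hE'.compact hE'.convex (a - t • u)) (J_convex K' (a - t • u))
    have h2 : volume (J K (a + t • u)) ≤ F K0 a := by
      rw [hE0.bdry ha hai]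
      exact (hE.le _ hapK).trans (mul_le_mul_right (vol_St_ge hu hK hKc) _)
    have h3 : volume (J K' (a - t • u)) ≤ F K0 a := by
      rw [hE0.bdry ha hai]
      refine (hE'.le _ hamK).trans (mul_le_mul_right ?_ _)
      rw [hK', vol_rho]
      exact vol_St_ge hu hK hKc
    have h4 := h1.trans (add_le_add h2 h3)
    rw [← two_mul] at h4
    exact (ENNReal.mul_le_mul_iff_right (by norm_num) (by norm_num)).1 h4
  have hV : Hf u (J K (a + t • u)) (J K' (a - t • u)) ⊆ J K0 a := by
    refine subset_of_vol_le (J_compact hE0.compact hE0.convex a).isClosed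
      (Hf_convex (J_convex _ _) (J_convex _ _)) ?_ hsub hv
      (F_lt_top hE0.compact hE0.convex a).ne
    exact hE0.int.mono (interior_mono ((subset_J K0 a).trans hsub))
  -- height bound
  have hbd : ∀ h, Pt u p h ∈ J K0 a → h ≤ Ll u K p := by
    intro h hh
    rw [mem_J_symm hE0.convex ⟨a, ha⟩ hs] at hh
    obtain ⟨s, hs, hz⟩ := hh
    rw [Pt_sub, hK0, mem_St_iff hu hK hKc] at hz
    have h1 := hc s hs.1 hz.1
    have h2 := (abs_le.1 hz.2).2
    linarith
  have hnp : -p ∈ Om u K := Om_neg hu hK hKc hs hp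
  set x := p - (2*ε) • a with hxd
  have hX : Pt u p ((1/(1+ε)) * Gt u K x + (ε/(1+ε)) * (2 * (⟪u,a⟫ + t) + Gt u K' (-p))) ∈
      J K (a + t • u) := by
    rw [mem_J hKc ⟨_, hapK⟩]
    refine ⟨_, Gt_mem hu hK hx, _, bot_mem hu hK hnp, ε/(1+ε), ⟨by positivity, ?_⟩, ?_⟩
    · rw [div_le_one (by linarith)]; linarith
    · have e1 : 1 - ε/(1+ε) = 1/(1+ε) := by field_simp; ring
      have e2 : (2:ℝ) • (a + t • u) - Pt u (-p) (-Gt u K' (-p)) =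
          Pt u ((2:ℝ) • a + (-1 : ℝ) • (-p)) (2 * (⟪u,a⟫ + t) + (-1) * (-Gt u K' (-p))) := by
        rw [Pt_comb, hap]; module
      rw [e1, e2, ← Pt_comb]
      congr 1
      · rw [hxd]
        have h3 : (1/(1+ε)) + ε/(1+ε) = 1 := by field_simp
        have h4 : (1/(1+ε)) * (2*ε) = (ε/(1+ε)) * 2 := by field_simp
        rw [smul_sub, smul_smul, h4, smul_add, smul_smul]
        calc p = ((1/(1+ε)) + ε/(1+ε)) • p := by rw [h3, one_smul]
          _ = _ := by module
      · ring
  have hY : Pt u p (Gt u K' p) ∈ J K' (a - t • u) :=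
    subset_J _ _ (Gt_mem hu hE'.compact (by rwa [hK', Om_rho hu]))
  set A := (1/(1+ε)) * Gt u K x + (ε/(1+ε)) * (2 * (⟪u,a⟫ + t) + Gt u K' (-p)) with hA
  have hZ : Pt u p ((A + Gt u K' p)/2) ∈ J K0 a := by
    refine hV ⟨(A - Gt u K' p)/2, ?_, ?_⟩
    · rw [Pt_add_smul]; convert hX using 2; ring
    · rw [sub_eq_add_neg (Pt u p _), ← neg_smul, Pt_add_smul]; convert hY using 2; ring
  have hfin := hbd _ hZ
  have hAG : A ≤ Gt u K p := by simp only [Ll] at hfin; linarith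
  have hln := Ll_neg hu hK hKc hs hp
  have hA2 : (1+ε) * A = Gt u K x + ε * (2 * (⟪u,a⟫ + t) + Gt u K' (-p)) := by
    rw [hA]; field_simp
  have hA3 : (1+ε) * A ≤ (1+ε) * Gt u K p := by gcongr
  rw [hA2] at hA3
  have q1 : Gt u K x = Ll u K x + Mu u K x := by simp only [Ll, Mu]; ring
  have q2 : Gt u K' (-p) = Ll u K p - Mu u K (-p) := by rw [← hln]; simp only [Ll, Mu]; ring
  have q3 : Gt u K p = Ll u K p + Mu u K p := by simp only [Ll, Mu]; ring
  rw [q1, q2, q3] at hA3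
  linarith

lemma key_abs {n : ℕ} {u : Eu (n+1)} (hu : ‖u‖ = 1) {K : Set (Eu (n+1))} (hE : Extremal K)
    (hs : ∀ x ∈ St u K, -x ∈ St u K) {a p : Eu (n+1)} (ha : a ∈ St u K)
    (hai : a ∉ interior (St u K)) (hp : p ∈ Om u K)
    (hc : ∀ s : ℝ, 0 ≤ s → p - s • a ∈ Om u K → Ll u K (p - s • a) ≤ Ll u K p - s * ⟪u, a⟫)
    {ε : ℝ} (hε : 0 < ε) (hx : p - (2*ε) • a ∈ Om u K) :
    |Mu u K (p - (2*ε) • a) - Mu u K p + ε * (2 * Mu u K a - Mu u K p - Mu u K (-p))| ≤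
      Ll u K p - Ll u K (p - (2*ε) • a) - 2 * ε * ⟪u, a⟫ := by
  rw [abs_le]
  refine ⟨?_, key_plus hu hE hs ha hai hp hc hε hx⟩
  have := key_plus hu (hE.rho u) (by rwa [St_rho hu]) (by rwa [St_rho hu]) (by rwa [St_rho hu])
    (p := p) (by rwa [Om_rho hu]) (by rw [Om_rho hu]; simpa only [Ll_rho] using hc) hε (by rwa [Om_rho hu])
  simp only [Ll_rho, Mu_rho] at this
  linarith

/-- derivative comparison -/
lemma deriv_zero_of_abs_le {f g : ℝ → ℝ} {A : ℝ} (hf : HasDerivAt f A 0) (hg : HasDerivAt g 0 0)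
    (f0 : f 0 = 0) (g0 : g 0 = 0) (h : ∀ᶠ ε in 𝓝[>] (0:ℝ), |f ε| ≤ g ε) : A = 0 := by
  have h1 := hf.tendsto_slope_zero_right
  have h2 := hg.tendsto_slope_zero_right
  simp only [zero_add, f0, g0, sub_zero, smul_eq_mul] at h1 h2
  have : |A| ≤ 0 := by
    refine le_of_tendsto_of_tendsto h1.abs h2 ?_
    filter_upwards [h, self_mem_nhdsWithin] with ε he hpos
    rw [abs_mul, abs_of_pos (inv_pos.2 hpos)]
    exact mul_le_mul_of_nonneg_left he (inv_pos.2 hpos).le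
  simpa using this

lemma concave_le_deriv {E : Type*} [AddCommGroup E] [Module ℝ E] {s : Set E} {φ : E → ℝ}
    (hφ : ConcaveOn ℝ s φ) {p x : E} (hp : p ∈ s) (hx : x ∈ s) {B : ℝ}
    (hB : HasDerivAt (fun t : ℝ => φ (p + t • (x - p))) B 0) : φ x ≤ φ p + B := by
  have h1 := hB.tendsto_slope_zero_right
  simp only [zero_add, zero_smul, add_zero, smul_eq_mul] at h1
  have : φ x - φ p ≤ B := by
    refine ge_of_tendsto h1 ?_
    filter_upwards [Ioo_mem_nhdsGT (zero_lt_one' ℝ)] with t ht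
    have := hφ.2 hp hx (sub_nonneg.2 ht.2.le) ht.1.le (by ring)
    rw [show (1 - t) • p + t • x = p + t • (x - p) by module] at this
    simp only [smul_eq_mul] at this
    rw [le_inv_mul_iff₀ ht.1]
    linarith
  linarith

lemma key_deriv {n : ℕ} {u : Eu (n+1)} (hu : ‖u‖ = 1) {K : Set (Eu (n+1))} (hE : Extremal K)
    (hs : ∀ x ∈ St u K, -x ∈ St u K) {a p : Eu (n+1)} (ha : a ∈ St u K)
    (hai : a ∉ interior (St u K)) (hp : p ∈ interior (Om u K)) {A : ℝ}
    (hl : HasDerivAt (fun s : ℝ => Ll u K (p - s • a)) (-⟪u, a⟫) 0)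
    (hm : HasDerivAt (fun s : ℝ => Mu u K (p - s • a)) A 0) :
    2 * A + 2 * Mu u K a - Mu u K p - Mu u K (-p) = 0 := by
  have hpO := interior_subset hp
  have hc : ∀ s : ℝ, 0 ≤ s → p - s • a ∈ Om u K → Ll u K (p - s • a) ≤ Ll u K p - s * ⟪u, a⟫ := by
    intro s _ hx
    rw [sub_eq_add_neg]
    refine concave_le_deriv (Ll_concave hu hE.compact hE.convex) hpO hx ?_
    have h0 : HasDerivAt (fun t : ℝ => t * s) s 0 := by
      simpa using (hasDerivAt_id (0:ℝ)).mul_const s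
    have h1 : HasDerivAt (fun s : ℝ => Ll u K (p - s • a)) (-⟪u, a⟫) (0 * s) := by
      rwa [zero_mul]
    have := HasDerivAt.comp (0:ℝ) h1 h0
    have e : (fun t : ℝ => Ll u K (p + t • (p - s • a - p))) =
        (fun s : ℝ => Ll u K (p - s • a)) ∘ fun t => t * s := by
      ext t; simp only [Function.comp]; congr 1; module
    rw [e]
    exact this.congr_deriv (by ring)
  have h0 : HasDerivAt (fun t : ℝ => 2 * t) 2 0 := by
    simpa using (hasDerivAt_id (0:ℝ)).const_mul 2
  have hl' : HasDerivAt (fun ε : ℝ => Ll u K (p - (2*ε) • a)) (-⟪u, a⟫ * 2) 0 :=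
    HasDerivAt.comp (h₂ := fun s : ℝ => Ll u K (p - s • a)) (0:ℝ) (by rwa [mul_zero]) h0
  have hm' : HasDerivAt (fun ε : ℝ => Mu u K (p - (2*ε) • a)) (A * 2) 0 :=
    HasDerivAt.comp (h₂ := fun s : ℝ => Mu u K (p - s • a)) (0:ℝ) (by rwa [mul_zero]) h0
  have hev : ∀ᶠ ε in 𝓝[>] (0:ℝ), p - (2*ε) • a ∈ Om u K := by
    have hcont : Continuous fun ε : ℝ => p - (2*ε) • a := by fun_prop
    have : ∀ᶠ ε in 𝓝 (0:ℝ), p - (2*ε) • a ∈ interior (Om u K) :=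
      hcont.continuousAt.eventually_mem (isOpen_interior.mem_nhds (by simpa using hp))
    exact (this.filter_mono nhdsWithin_le_nhds).mono fun _ h => interior_subset h
  set C := 2 * Mu u K a - Mu u K p - Mu u K (-p) with hC
  have hf : HasDerivAt (fun ε : ℝ => Mu u K (p - (2*ε) • a) - Mu u K p + ε * C) (A * 2 + 1 * C) 0 :=
    (hm'.sub_const _).add ((hasDerivAt_id (0:ℝ)).mul_const C)
  have hg : HasDerivAt (fun ε : ℝ => Ll u K p - Ll u K (p - (2*ε) • a) - ε * (2 * ⟪u, a⟫)) 0 0 := by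
    exact ((hl'.const_sub (Ll u K p)).sub
      ((hasDerivAt_id (0:ℝ)).mul_const (2 * ⟪u, a⟫))).congr_deriv (by ring)
  have := deriv_zero_of_abs_le hf hg (by simp) (by simp) (by
    filter_upwards [hev, self_mem_nhdsWithin] with ε h1 h2
    refine (key_abs hu hE hs ha hai hpO hc h2 h1).trans (le_of_eq ?_)
    ring)
  linarith

lemma lip_tool {f : ℝ → ℝ} {C : ℝ≥0} {a b S : ℝ} (hab : a ≤ b) (hf : LipschitzOnWith C f (Icc a b))
    (h : ∀ᵐ x, x ∈ Ioo a b → ∃ f', HasDerivAt f f' x ∧ f' ≤ S) : f b - f a ≤ S * (b - a) := by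
  have hac : AbsolutelyContinuousOnInterval f a b :=
    LipschitzOnWith.absolutelyContinuousOnInterval (by rwa [uIcc_of_le hab])
  rw [← hac.integral_deriv_eq_sub]
  have : S * (b - a) = ∫ x in a..b, S := by simp [mul_comm]
  rw [this]
  refine intervalIntegral.integral_mono_ae_restrict hab hac.intervalIntegrable_deriv
    intervalIntegrable_const ?_
  rw [← restrict_Ioo_eq_restrict_Icc]
  refine (ae_restrict_iff' measurableSet_Ioo).2 ?_
  filter_upwards [h] with x hx hx'
  obtain ⟨f', h1, h2⟩ := hx hx'
  rw [h1.deriv]; exact h2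

lemma odd_lin {w m : ℝ} (hw : 0 < w) (hm : 0 < m) (hmw : m ≤ w / 2) {o : ℝ → ℝ}
    (hcont : ContinuousOn o (Icc 0 w)) (h0 : o 0 = 0)
    (hlip : ∀ b < w, ∃ C, LipschitzOnWith C o (Icc 0 b))
    (hd : ∀ᵐ x, x ∈ Ioo 0 w → ∃ t, 0 < t ∧ t ≤ w ∧ HasDerivAt o (o t / t) x ∧ (x < w/2 → m ≤ t)) :
    ∃ S q, 0 < q ∧ q ≤ w ∧ (∀ x ∈ Icc 0 w, o x ≤ S * x) ∧ ∀ x ∈ Icc 0 q, o x = S * x := by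
  have hsub : Icc m w ⊆ Icc 0 w := Icc_subset_Icc hm.le le_rfl
  obtain ⟨q, hq, hmax⟩ := (isCompact_Icc (a := m) (b := w)).exists_isMaxOn ⟨w, by linarith, le_rfl⟩
    ((hcont.mono hsub).div continuousOn_id (fun x hx => (hm.trans_le hx.1).ne'))
  have hq0 : 0 < q := hm.trans_le hq.1
  set S := o q / q with hS
  have hr : ∀ x ∈ Icc m w, o x / x ≤ S := fun x hx => hmax hx
  have hoq : o q = S * q := by rw [hS]; field_simp
  have h1 : ∀ x ∈ Icc 0 w, o x ≤ S * x := by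
    intro x hx
    rcases le_or_gt m x with hxm | hxm
    · have := hr x ⟨hxm, hx.2⟩
      rwa [div_le_iff₀ (by linarith)] at this
    · obtain ⟨C, hC⟩ := hlip x (by linarith)
      have := lip_tool hx.1 hC (S := S) (by
        filter_upwards [hd] with y hy hy'
        obtain ⟨t, _, h2, h3, h4⟩ := hy ⟨hy'.1, by linarith [hy'.2]⟩
        exact ⟨_, h3, hr t ⟨h4 (by linarith [hy'.2]), h2⟩⟩)
      rw [h0] at this; linarith
  have h2 : ∀ x ∈ Icc 0 w, ∀ y ∈ Ico x w, o y ≤ o x + S * (y - x) := by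
    intro x hx y hy
    obtain ⟨C, hC⟩ := hlip y hy.2
    have := lip_tool hy.1 (hC.mono (Icc_subset_Icc hx.1 le_rfl)) (S := S) (by
      filter_upwards [hd] with z hz hz'
      obtain ⟨t, h1', h2, h3, h4⟩ := hz ⟨by linarith [hx.1, hz'.1], by linarith [hz'.2, hy.2]⟩
      refine ⟨_, h3, ?_⟩
      rw [div_le_iff₀ h1']
      exact h1 t ⟨h1'.le, h2⟩)
    linarith
  have h3 : ∀ x ∈ Icc 0 w, ∀ y ∈ Icc x w, o y ≤ o x + S * (y - x) := by
    intro x hx y hy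
    rcases hx.2.eq_or_lt with rfl | hxw
    · have : y = x := le_antisymm hy.2 hy.1
      simp [this]
    have hcl : closure (Ico x w) = Icc x w := closure_Ico hxw.ne
    refine le_on_closure (s := Ico x w) (f := o) (g := fun y => o x + S * (y - x)) (h2 x hx) ?_
      (by fun_prop) (by rwa [hcl])
    rw [hcl]; exact hcont.mono (Icc_subset_Icc hx.1 le_rfl)
  refine ⟨S, q, hq0, hq.2, h1, fun x hx => le_antisymm (h1 x ⟨hx.1, hx.2.trans hq.2⟩) ?_⟩
  have := h3 x ⟨hx.1, hx.2.trans hq.2⟩ q ⟨hx.2, hq.2⟩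
  rw [hoq] at this
  linarith

lemma line_thm {w : ℝ} (hw : 0 < w) {l ν : ℝ → ℝ}
    (hlc : ∀ b < w, ∃ C, LipschitzOnWith C l (ball 0 b))
    (hνl : ∀ b < w, ∃ C, LipschitzOnWith C ν (ball 0 b))
    (hνc : ContinuousOn ν (Icc (-w) w)) (hle : ∀ q ∈ Ioo (-w) w, l (-q) = l q)
    {T : ℝ → ℝ} (hTs : ∀ σ, T (-σ) = T σ) (hT : ∀ σ, 0 < T σ ∧ T σ ≤ w)
    (hTm : ∀ M, ∃ m > 0, ∀ σ, |σ| ≤ M → m ≤ T σ)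
    (hkey : ∀ q ∈ Ioo (-w) w, ∀ σ ν', HasDerivAt l σ q → HasDerivAt ν ν' q →
      2 * (T σ * ν') = 2 * ν (T σ) - ν q - ν (-q) ∧
      2 * (T σ * ν') = ν q + ν (-q) - 2 * ν (-T σ)) :
    ∃ A e, ∀ q ∈ Icc (-w) w, ν q = e + A * q := by
  have hball : ∀ r : ℝ, ball (0:ℝ) r = Ioo (-r) r := fun r => by simp [Real.ball_eq_Ioo]
  have hmaps : ∀ b : ℝ, MapsTo (fun x : ℝ => -x) (ball 0 b) (ball 0 b) := fun b x hx => by simpa using hx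
  have hnl : ∀ b < w, ∃ C, LipschitzOnWith C (fun x => ν (-x)) (ball 0 b) := by
    intro b hb
    obtain ⟨C, hC⟩ := hνl b hb
    exact ⟨C * 1, hC.comp (LipschitzWith.id.neg.lipschitzOnWith) (hmaps b)⟩
  -- a.e. differentiability
  have hae : ∀ f : ℝ → ℝ, (∀ b < w, ∃ C, LipschitzOnWith C f (ball 0 b)) →
      ∀ᵐ x, x ∈ Ioo (-w) w → DifferentiableAt ℝ f x := by
    intro f hf
    have : ∀ k : ℕ, ∀ᵐ x, x ∈ ball (0:ℝ) (w - w / (k+1)) → DifferentiableAt ℝ f x := by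
      intro k
      obtain ⟨C, hC⟩ := hf (w - w/(k+1)) (by have : 0 < w/((k:ℝ)+1) := by positivity
                                             linarith)
      filter_upwards [hC.ae_differentiableWithinAt_of_mem_real] with x hx hx'
      exact (hx hx').differentiableAt (isOpen_ball.mem_nhds hx')
    filter_upwards [ae_all_iff.2 this] with x hx hx'
    have hlt : |x| < w := abs_lt.2 hx'
    obtain ⟨k, hk⟩ := exists_nat_gt (w / (w - |x|))
    refine hx k ?_
    rw [mem_ball_zero_iff, Real.norm_eq_abs]
    rw [div_lt_iff₀ (by linarith)] at hk
    have : w / ((k:ℝ)+1) < w - |x| := by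
      rw [div_lt_iff₀ (by positivity)]; nlinarith
    linarith
  have hgood : ∀ᵐ q, q ∈ Ioo (-w) w → ∃ σ, HasDerivAt l σ q ∧
      HasDerivAt (fun x => ν x + ν (-x)) 0 q ∧
      HasDerivAt (fun x => ν x - ν (-x)) ((ν (T σ) - ν (-T σ)) / T σ) q := by
    filter_upwards [hae l hlc, hae ν hνl, hae _ hnl] with q h1 h2 h3 hq
    have d1 := (h1 hq).hasDerivAt
    have d2 := (h2 hq).hasDerivAt
    have d3 := (h3 hq).hasDerivAt
    set σ := deriv l q
    set n1 := deriv ν q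
    set n2 := deriv (fun x => ν (-x)) q
    have hq' : -q ∈ Ioo (-w) w := ⟨by linarith [hq.2], by linarith [hq.1]⟩
    have e1 : HasDerivAt ν (-n2) (-q) := by
      have := HasDerivAt.comp (-q) (h := fun x : ℝ => -x) (by rwa [neg_neg]) (hasDerivAt_neg (-q))
      simpa [Function.comp_def] using this
    have e2 : HasDerivAt l (-σ) (-q) := by
      have := HasDerivAt.comp (-q) (h₂ := l) (h₂' := σ) (h := fun x : ℝ => -x) (by rwa [neg_neg]) (hasDerivAt_neg (-q))
      simp only [mul_neg, mul_one] at this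
      refine this.congr_of_eventuallyEq ?_
      filter_upwards [isOpen_Ioo.mem_nhds hq'] with x hx
      exact (hle x hx).symm
    obtain ⟨k1, k2⟩ := hkey q hq σ n1 d1 d2
    obtain ⟨k3, k4⟩ := hkey (-q) hq' (-σ) (-n2) e2 e1
    rw [hTs, neg_neg] at k3 k4
    have hTp := (hT σ).1
    have hn : n1 + n2 = 0 := by
      have : T σ * (n1 + n2) = 0 := by linarith
      exact (mul_eq_zero.1 this).resolve_left hTp.ne'
    refine ⟨σ, d1, hn ▸ d2.add d3, (d2.sub d3).congr_deriv ?_⟩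
    rw [eq_div_iff hTp.ne']
    linarith
  have hlipsub : ∀ b < w, ∀ f : ℝ → ℝ, (∀ b < w, ∃ C, LipschitzOnWith C f (ball 0 b)) →
      ∃ C, LipschitzOnWith C f (Icc 0 b) := by
    intro b hb f hf
    rcases lt_or_ge b 0 with h | h
    · exact ⟨0, by rw [Icc_eq_empty (by linarith)]; exact lipschitzOnWith_empty _ _⟩
    · obtain ⟨C, hC⟩ := hf ((b+w)/2) (by linarith)
      exact ⟨C, hC.mono (by rw [hball]; exact Icc_subset_Ioo (by linarith) (by linarith))⟩
  have hneg : ContinuousOn (fun x => ν (-x)) (Icc (-w) w) :=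
    hνc.comp continuousOn_neg (fun x hx => ⟨by linarith [hx.2], by linarith [hx.1]⟩)
  have hsubw : Icc 0 w ⊆ Icc (-w) w := Icc_subset_Icc (by linarith) le_rfl
  -- even part
  have hev1 : ∀ q ∈ Ico 0 w, ν q + ν (-q) = 2 * ν 0 := by
    intro q hq
    obtain ⟨C1, hC1⟩ := hlipsub q hq.2 ν hνl
    obtain ⟨C2, hC2⟩ := hlipsub q hq.2 _ hnl
    have a1 := lip_tool hq.1 (hC1.add hC2) (S := 0) (by
      filter_upwards [hgood] with x hx hx'
      obtain ⟨σ, _, h2, _⟩ := hx ⟨by linarith [hx'.1], by linarith [hx'.2, hq.2]⟩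
      exact ⟨0, h2, le_rfl⟩)
    have a2 := lip_tool hq.1 (hC1.add hC2).neg (S := 0) (by
      filter_upwards [hgood] with x hx hx'
      obtain ⟨σ, _, h2, _⟩ := hx ⟨by linarith [hx'.1], by linarith [hx'.2, hq.2]⟩
      exact ⟨-0, h2.neg, by simp⟩)
    simp only [Pi.add_apply, Pi.neg_apply, neg_zero, zero_mul] at a1 a2
    linarith
  have hev : ∀ q ∈ Icc 0 w, ν q + ν (-q) = 2 * ν 0 := by
    have hcl : closure (Ico 0 w) = Icc 0 w := closure_Ico hw.ne
    have h1 : EqOn (fun q => ν q + ν (-q)) (fun _ => 2 * ν 0) (Ico 0 w) := hev1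
    exact h1.of_subset_closure ((hνc.add hneg).mono hsubw) continuousOn_const
      Ico_subset_Icc_self hcl.ge
  -- odd part
  obtain ⟨C, hC⟩ := hlc (w/2) (by linarith)
  obtain ⟨m0, hm0, hm0'⟩ := hTm C
  have hodd : ∀ s : ℝ, (s = 1 ∨ s = -1) → ∃ S q, 0 < q ∧ q ≤ w ∧
      (∀ x ∈ Icc 0 w, s * (ν x - ν (-x)) ≤ S * x) ∧ ∀ x ∈ Icc 0 q, s * (ν x - ν (-x)) = S * x := by
    intro s hs
    refine odd_lin (o := fun x => s * (ν x - ν (-x))) hw (lt_min hm0 (half_pos hw)) (min_le_right _ _) ?_ ?_ ?_ ?_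
    · exact ((hνc.sub hneg).mono hsubw).const_smul s
    · simp
    · intro b hb
      obtain ⟨C1, hC1⟩ := hlipsub b hb ν hνl
      obtain ⟨C2, hC2⟩ := hlipsub b hb _ hnl
      have := hC1.sub hC2
      rcases hs with rfl | rfl
      · exact ⟨_, by simpa using this⟩
      · refine ⟨C1 + C2, ?_⟩
        have e : (fun x => -1 * (ν x - ν (-x))) = -(fun x => ν x - ν (-x)) := by ext x; simp
        rw [e]; exact this.neg
    · filter_upwards [hgood] with x hx hx'
      obtain ⟨σ, h1, _, h3⟩ := hx ⟨by linarith [hx'.1], hx'.2⟩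
      refine ⟨T σ, (hT σ).1, (hT σ).2, (h3.const_mul s).congr_deriv (by ring), fun hlt => ?_⟩
      refine (min_le_left _ _).trans (hm0' σ ?_)
      have hxb : x ∈ ball (0:ℝ) (w/2) := by rw [hball]; exact ⟨by linarith [hx'.1], hlt⟩
      have := norm_deriv_le_of_lipschitzOn (isOpen_ball.mem_nhds hxb) hC
      rwa [h1.deriv] at this
  obtain ⟨S1, q1, hq1, hq1w, hS1, hS1'⟩ := hodd 1 (Or.inl rfl)
  obtain ⟨S2, q2, hq2, hq2w, hS2, hS2'⟩ := hodd (-1) (Or.inr rfl)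
  have hSS : S2 = -S1 := by
    have hq : 0 < min q1 q2 := lt_min hq1 hq2
    have a1 := hS1' (min q1 q2) ⟨hq.le, min_le_left _ _⟩
    have a2 := hS2' (min q1 q2) ⟨hq.le, min_le_right _ _⟩
    have : (S1 + S2) * min q1 q2 = 0 := by linarith
    have := (mul_eq_zero.1 this).resolve_right hq.ne'
    linarith
  have hod : ∀ q ∈ Icc 0 w, ν q - ν (-q) = S1 * q := by
    intro q hq
    have a1 := hS1 q hq
    have a2 := hS2 q hq
    rw [hSS] at a2
    linarith
  refine ⟨S1/2, ν 0, fun q hq => ?_⟩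
  rcases le_total 0 q with h | h
  · have a1 := hev q ⟨h, hq.2⟩
    have a2 := hod q ⟨h, hq.2⟩
    linarith
  · have a1 := hev (-q) ⟨by linarith, by linarith [hq.1]⟩
    have a2 := hod (-q) ⟨by linarith, by linarith [hq.1]⟩
    rw [neg_neg] at a1 a2
    linarith

/-- radial function -/
noncomputable def rad {d : ℕ} (K : Set (Eu d)) (y : Eu d) : ℝ := sSup {t : ℝ | t • y ∈ K}

section rad
variable {d : ℕ} {K : Set (Eu d)} {y : Eu d}

lemma zero_mem_interior (hKc : Convex ℝ K) (hi : (interior K).Nonempty) (hs : ∀ x ∈ K, -x ∈ K) :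
    (0 : Eu d) ∈ interior K := by
  obtain ⟨x, hx⟩ := hi
  have := hKc.combo_interior_self_mem_interior hx (hs x (interior_subset hx))
    (a := 1/2) (b := 1/2) (by norm_num) (by norm_num) (by norm_num)
  simpa using this

lemma rad_compact (hK : IsCompact K) (hy : y ≠ 0) : IsCompact {t : ℝ | t • y ∈ K} := by
  obtain ⟨R, hR⟩ := hK.isBounded.subset_closedBall 0
  have hy' : 0 < ‖y‖ := norm_pos_iff.2 hy
  refine (isCompact_Icc (a := -(R/‖y‖)) (b := R/‖y‖)).of_isClosed_subset ?_ ?_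
  · exact hK.isClosed.preimage (by fun_prop : Continuous fun t : ℝ => t • y)
  · intro t ht
    have h1 : ‖t • y‖ ≤ R := by simpa using hR ht
    rw [norm_smul, Real.norm_eq_abs, ← le_div_iff₀ hy'] at h1
    exact abs_le.1 h1

lemma le_rad (hK : IsCompact K) (hy : y ≠ 0) {t : ℝ} (ht : t • y ∈ K) : t ≤ rad K y :=
  le_csSup (rad_compact hK hy).bddAbove ht

lemma rad_mem (hK : IsCompact K) (hy : y ≠ 0) (h0 : (0 : Eu d) ∈ K) : rad K y • y ∈ K :=
  (rad_compact hK hy).sSup_mem ⟨0, by simpa using h0⟩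

lemma rad_ge (hK : IsCompact K) (hy : y ≠ 0) {r : ℝ} (hr : 0 < r) (hb : closedBall 0 r ⊆ K) :
    r / ‖y‖ ≤ rad K y := by
  have hy' : 0 < ‖y‖ := norm_pos_iff.2 hy
  refine le_rad hK hy (hb ?_)
  rw [mem_closedBall_zero_iff, norm_smul, Real.norm_eq_abs, abs_of_pos (by positivity)]
  field_simp; rfl

lemma rad_pos (hK : IsCompact K) (hy : y ≠ 0) (h0 : (0 : Eu d) ∈ interior K) : 0 < rad K y := by
  obtain ⟨r, hr, hb⟩ := Metric.nhds_basis_closedBall.mem_iff.1 (mem_interior_iff_mem_nhds.1 h0)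
  have hy' : 0 < ‖y‖ := norm_pos_iff.2 hy
  exact lt_of_lt_of_le (by positivity) (rad_ge hK hy hr hb)

lemma rad_not_mem (hK : IsCompact K) (hy : y ≠ 0) : rad K y • y ∉ interior K := by
  intro h
  have hc : ContinuousAt (fun t : ℝ => t • y) (rad K y) := by fun_prop
  have h1 : ∀ᶠ t in 𝓝[>] (rad K y), t • y ∈ interior K :=
    (hc.eventually_mem (isOpen_interior.mem_nhds h)).filter_mono nhdsWithin_le_nhds
  obtain ⟨t, ht, ht'⟩ := (h1.and self_mem_nhdsWithin).exists
  exact absurd (le_rad hK hy (interior_subset ht)) (not_le.2 ht')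

lemma mem_of_le_rad (hK : IsCompact K) (hKc : Convex ℝ K) (hs : ∀ x ∈ K, -x ∈ K) (hy : y ≠ 0)
    (h0 : (0 : Eu d) ∈ interior K) {q : ℝ} : q • y ∈ K ↔ q ∈ Icc (-rad K y) (rad K y) := by
  have hm := rad_mem hK hy (interior_subset h0)
  constructor
  · intro h
    refine ⟨?_, le_rad hK hy h⟩
    have := le_rad hK hy (t := -q) (by rw [neg_smul]; exact hs _ h)
    linarith
  · intro h
    have hcv : Convex ℝ {t : ℝ | t • y ∈ K} := by
      intro a ha b hb s t hs ht hst
      have := hKc ha hb hs ht hst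
      simp only [smul_smul, ← add_smul] at this
      exact this
    exact hcv.ordConnected.out (by simpa [neg_smul] using hs _ hm) hm h

lemma mem_interior_of_lt_rad (hK : IsCompact K) (hKc : Convex ℝ K) (hs : ∀ x ∈ K, -x ∈ K)
    (hy : y ≠ 0) (h0 : (0 : Eu d) ∈ interior K) {q : ℝ} (hq : q ∈ Ioo (-rad K y) (rad K y)) :
    q • y ∈ interior K := by
  have hlt : |q| < rad K y := abs_lt.2 hq
  obtain ⟨s, hs1, hs2⟩ := exists_between hlt
  have hsp : 0 < s := (abs_nonneg q).trans_lt hs1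
  set t := rad K y
  have htp : 0 < t := hsp.trans hs2
  have h1 : ((q / (|q| / t + (1 - |q|/t)))) • y = q • y := by
    congr 1; rw [show |q|/t + (1 - |q|/t) = 1 by ring, div_one]
  have hsg : ∃ z ∈ K, q • y = (|q|/t) • z := by
    have hm := rad_mem hK hy (interior_subset h0)
    rcases le_total 0 q with h | h
    · refine ⟨_, hm, ?_⟩
      rw [smul_smul, abs_of_nonneg h]; congr 1; field_simp; rfl
    · refine ⟨_, hs _ hm, ?_⟩
      rw [smul_neg, smul_smul, abs_of_nonpos h, ← neg_smul]; congr 1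
      change q = _ ; field_simp; simp; exact Or.inl rfl
  obtain ⟨z, hz, e⟩ := hsg
  have := hKc.combo_interior_self_mem_interior h0 hz (a := 1 - |q|/t) (b := |q|/t)
    (by rw [sub_pos, div_lt_one htp]; exact hlt) (by positivity) (by ring)
  rwa [smul_zero, zero_add, ← e] at this

end rad

/-- concave and upper semicontinuous on a segment implies continuous -/
lemma concave_usc_cont {f : ℝ → ℝ} {a b : ℝ} (hf : ConcaveOn ℝ (Icc a b) f)
    (hu : ∀ x ∈ Icc a b, ∀ c, f x < c → ∀ᶠ y in 𝓝[Icc a b] x, f y < c) :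
    ContinuousOn f (Icc a b) := by
  intro x hx
  refine tendsto_order.2 ⟨fun c hc => ?_, hu x hx⟩
  set C1 := (f b - f x) / (b - x)
  set C2 := (f a - f x) / (x - a)
  have hcomb : ∀ e ∈ Icc a b, ∀ s ∈ Icc (0:ℝ) 1, f x + s * (f e - f x) ≤ f (x + s * (e - x)) := by
    intro e he s hs
    have := hf.2 hx he (sub_nonneg.2 hs.2) hs.1 (by ring)
    simp only [smul_eq_mul] at this
    rw [show (1 - s) * x + s * e = x + s * (e - x) by ring] at this
    linarith
  have hl : ∀ y ∈ Icc a b, f x - (|C1| + |C2|) * |y - x| ≤ f y := by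
    intro y hy
    rcases lt_trichotomy y x with h | h | h
    · have hxa : 0 < x - a := by linarith [hy.1]
      have := hcomb a ⟨le_rfl, hx.1.trans hx.2⟩ ((x-y)/(x-a)) ⟨div_nonneg (by linarith) hxa.le, by
        rw [div_le_one hxa]; linarith [hy.1]⟩
      have e1 : x + (x - y)/(x - a) * (a - x) = y := by field_simp; ring
      have e2 : (x - y)/(x - a) * (f a - f x) = C2 * (x - y) := by simp only [C2]; ring
      rw [e1, e2] at this
      have h3 : -(|C2|) ≤ C2 := neg_abs_le _
      rw [abs_of_neg (by linarith : y - x < 0)]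
      nlinarith [abs_nonneg C1, mul_nonneg (abs_nonneg C1) (by linarith : 0 ≤ x - y)]
    · simp [h]
    · have hxa : 0 < b - x := by linarith [hy.2]
      have := hcomb b ⟨hx.1.trans hx.2, le_rfl⟩ ((y-x)/(b-x)) ⟨div_nonneg (by linarith) hxa.le, by
        rw [div_le_one hxa]; linarith [hy.2]⟩
      have e1 : x + (y-x)/(b-x) * (b - x) = y := by field_simp; ring
      have e2 : (y-x)/(b-x) * (f b - f x) = C1 * (y - x) := by simp only [C1]; ring
      rw [e1, e2] at this
      have h3 : -(|C1|) ≤ C1 := neg_abs_le _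
      rw [abs_of_pos (by linarith : 0 < y - x)]
      nlinarith [abs_nonneg C2, mul_nonneg (abs_nonneg C2) (by linarith : 0 ≤ y - x)]
  have hcont : ContinuousAt (fun y => f x - (|C1| + |C2|) * |y - x|) x := by fun_prop
  have := (hcont.eventually_const_lt (u := c) (by simpa using hc)).filter_mono
    (nhdsWithin_le_nhds (s := Icc a b))
  filter_upwards [this, self_mem_nhdsWithin] with y h1 h2
  exact h1.trans_le (hl y h2)

section line
variable {d : ℕ} {u : Eu d} {K : Set (Eu d)}

lemma Gt_bdd (hu : ‖u‖ = 1) (hK : IsCompact K) : ∃ R, ∀ x ∈ Om u K, |Gt u K x| ≤ R := by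
  obtain ⟨R, hR⟩ := hK.isBounded.subset_closedBall 0
  refine ⟨R, fun x hx => ?_⟩
  have h1 : ‖Pt u x (Gt u K x)‖ ≤ R := by simpa using hR (Gt_mem hu hK hx)
  have h2 := abs_real_inner_le_norm u (Pt u x (Gt u K x))
  rw [inner_Pt hu, hu, one_mul] at h2
  exact h2.trans h1

lemma Gt_line_concave (hu : ‖u‖ = 1) (hK : IsCompact K) (hKc : Convex ℝ K) {v : Eu d} {w : ℝ}
    (hD : ∀ q ∈ Icc (-w) w, q • v ∈ Om u K) :
    ConcaveOn ℝ (Icc (-w) w) fun q : ℝ => Gt u K (q • v) := by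
  refine ⟨convex_Icc _ _, fun x hx y hy a b ha hb hab => ?_⟩
  have := (Gt_concave hu hK hKc).2 (hD x hx) (hD y hy) ha hb hab
  simpa [add_smul, smul_smul] using this

lemma Gt_line_cont (hu : ‖u‖ = 1) (hK : IsCompact K) (hKc : Convex ℝ K) {v : Eu d} {w : ℝ}
    (hD : ∀ q ∈ Icc (-w) w, q • v ∈ Om u K) :
    ContinuousOn (fun q : ℝ => Gt u K (q • v)) (Icc (-w) w) := by
  refine concave_usc_cont (Gt_line_concave hu hK hKc hD) ?_
  intro x hx c hc
  obtain ⟨R, hR⟩ := Gt_bdd hu hK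
  have hcomp : IsCompact {p : ℝ × ℝ | p ∈ Icc (-w) w ×ˢ Icc (-R) R ∧ (Pt u (p.1 • v) p.2 ∈ K ∧ c ≤ p.2)} := by
    refine (isCompact_Icc.prod isCompact_Icc).inter_right (IsClosed.inter ?_ ?_)
    · exact hK.isClosed.preimage ((Pt_continuous u).comp
        (by fun_prop : Continuous fun p : ℝ × ℝ => (p.1 • v, p.2)))
    · exact isClosed_le continuous_const continuous_snd
  have hcl := (hcomp.image continuous_fst).isClosed
  have hx' : x ∈ (Prod.fst '' {p : ℝ × ℝ | p ∈ Icc (-w) w ×ˢ Icc (-R) R ∧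
      (Pt u (p.1 • v) p.2 ∈ K ∧ c ≤ p.2)})ᶜ := by
    rintro ⟨⟨p, h⟩, ⟨_, h1, h2⟩, rfl⟩
    have := le_Gt hu hK h1
    simp only at this h2 hc
    linarith
  filter_upwards [nhdsWithin_le_nhds (hcl.isOpen_compl.mem_nhds hx'), self_mem_nhdsWithin] with y hy hyD
  by_contra hcon
  refine hy ⟨(y, Gt u K (y • v)), ⟨⟨hyD, abs_le.1 (hR _ (hD y hyD))⟩, Gt_mem hu hK (hD y hyD),
    not_lt.1 hcon⟩, rfl⟩

lemma Gt_line_lip (hu : ‖u‖ = 1) (hK : IsCompact K) (hKc : Convex ℝ K) {v : Eu d} {w : ℝ}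
    (hD : ∀ q ∈ Icc (-w) w, q • v ∈ Om u K) {b : ℝ} (hb : b < w) :
    ∃ C, LipschitzOnWith C (fun q : ℝ => Gt u K (q • v)) (ball 0 b) := by
  obtain ⟨R, hR⟩ := Gt_bdd hu hK
  have hball : ball (0:ℝ) w ⊆ Icc (-w) w := by
    rw [Real.ball_eq_Ioo]; simpa using Ioo_subset_Icc_self
  have := ((Gt_line_concave hu hK hKc hD).subset hball (convex_ball _ _)).lipschitzOnWith_of_abs_le
    (ε := w - b) (M := R) (by linarith) (fun q hq => hR _ (hD q (hball hq)))
  exact ⟨_, by rwa [sub_sub_cancel] at this⟩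

end line

lemma lip_half {f : ℝ → ℝ} {C : ℝ≥0} {s : Set ℝ} (hf : LipschitzOnWith C f s) :
    ∃ C', LipschitzOnWith C' (fun x => f x / 2) s := by
  have := (lipschitzWith_smul (β := ℝ) (1/2:ℝ)).comp_lipschitzOnWith hf
  refine ⟨‖(1/2 : ℝ)‖₊ * C, ?_⟩
  have e : (fun x => f x / 2) = (fun x : ℝ => (1/2 : ℝ) • x) ∘ f := by
    funext x; simp only [Function.comp, smul_eq_mul]; ring
  rw [e]; exact this

theorem mu_line {n : ℕ} {u : Eu (n+1)} (hu : ‖u‖ = 1) {K : Set (Eu (n+1))} (hE : Extremal K)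
    (hs : ∀ x ∈ St u K, -x ∈ St u K) {v : Eu (n+1)} (huv : ⟪u, v⟫ = 0) (hv : v ≠ 0) :
    ∃ A e : ℝ, ∀ q : ℝ, q • v ∈ Om u K → Mu u K (q • v) = e + A * q := by
  have hE0 := hE.St hu
  have hE' := hE.rho u
  have hK := hE.compact
  have hKc := hE.convex
  set K0 := St u K with hK0
  have h0 : (0 : Eu (n+1)) ∈ interior K0 := zero_mem_interior hE0.convex hE0.int hs
  have hOmK0 : K0 ⊆ Om u K := by
    intro z hz
    rw [← Pt_self (u := u) z] at hz
    exact ((mem_St_iff hu hK hKc).1 hz).1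
  have hOmq : ∀ q : ℝ, q • v ∈ Om u K ↔ q • v ∈ K0 := by
    intro q
    refine ⟨fun h => ?_, fun h => hOmK0 h⟩
    have : Pt u (q • v) 0 ∈ K0 := (mem_St_iff hu hK hKc).2 ⟨h, by simpa using Ll_nonneg hu hK h⟩
    simpa [Pt, inner_smul_right, huv] using this
  set w := rad K0 v with hw
  have hwp : 0 < w := rad_pos hE0.compact hv h0
  have hD' : ∀ q : ℝ, q • v ∈ Om u K ↔ q ∈ Icc (-w) w := fun q => by
    rw [hOmq, mem_of_le_rad hE0.compact hE0.convex hs hv h0]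
  have hD : ∀ q ∈ Icc (-w) w, q • v ∈ Om u K := fun q => (hD' q).2
  have hDr : ∀ q ∈ Icc (-w) w, q • v ∈ Om u (rho u '' K) := by rwa [Om_rho hu]
  have hyne : ∀ σ : ℝ, v + σ • u ≠ 0 := by
    intro σ h
    have h1 : ⟪u, v + σ • u⟫ = 0 := by rw [h, inner_zero_right]
    rw [inner_add_right, inner_smul_right, inner_self_unit hu, huv] at h1
    have : σ = 0 := by linarith
    rw [this] at h; simp at h; exact hv h
  set T : ℝ → ℝ := fun σ => rad K0 (v + σ • u) with hT
  have hTmem : ∀ σ, T σ • (v + σ • u) ∈ K0 := fun σ =>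
    rad_mem hE0.compact (hyne σ) (interior_subset h0)
  have hTnot : ∀ σ, T σ • (v + σ • u) ∉ interior K0 := fun σ => rad_not_mem hE0.compact (hyne σ)
  have hlip1 : ∀ b < w, ∃ C, LipschitzOnWith C (fun q : ℝ => Ll u K (q • v)) (ball 0 b) := by
    intro b hb
    obtain ⟨C1, h1⟩ := Gt_line_lip hu hK hKc hD hb
    obtain ⟨C2, h2⟩ := Gt_line_lip hu hE'.compact hE'.convex hDr hb
    exact lip_half (h1.add h2)
  have hlip2 : ∀ b < w, ∃ C, LipschitzOnWith C (fun q : ℝ => Mu u K (q • v)) (ball 0 b) := by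
    intro b hb
    obtain ⟨C1, h1⟩ := Gt_line_lip hu hK hKc hD hb
    obtain ⟨C2, h2⟩ := Gt_line_lip hu hE'.compact hE'.convex hDr hb
    exact lip_half (h1.sub h2)
  have hcont : ContinuousOn (fun q : ℝ => Mu u K (q • v)) (Icc (-w) w) :=
    ((Gt_line_cont hu hK hKc hD).sub (Gt_line_cont hu hE'.compact hE'.convex hDr)).div_const 2
  have hneg_int : ∀ a : Eu (n+1), a ∉ interior K0 → -a ∉ interior K0 := by
    intro a ha h
    apply ha
    have h1 : a ∈ (Homeomorph.neg (Eu (n+1))) ⁻¹' interior K0 := by simpa using h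
    rw [Homeomorph.preimage_interior] at h1
    exact interior_mono (fun x hx => by have := hs _ hx; simpa using this) h1
  suffices hh : ∃ A e : ℝ, ∀ q ∈ Icc (-w) w, Mu u K (q • v) = e + A * q by
    obtain ⟨A, e, h⟩ := hh
    exact ⟨A, e, fun q hq => h q ((hD' q).1 hq)⟩
  refine line_thm hwp hlip1 hlip2 hcont (T := T) ?_ ?_ ?_ ?_ ?_
  · intro q hq
    rw [neg_smul]
    exact Ll_neg hu hK hKc hs (hD q ⟨hq.1.le, hq.2.le⟩)
  · intro σ
    have key : ∀ σ t : ℝ, t • (v + σ • u) ∈ K0 → t • (v + (-σ) • u) ∈ K0 := by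
      intro σ t ht
      have := St_rho_inv hu ht
      rw [rho_apply hu] at this
      simp only [inner_smul_right, inner_add_right, huv, inner_self_unit hu] at this
      convert this using 1
      module
    simp only [hT, rad]
    congr 1
    ext t
    exact ⟨fun h => by simpa using key _ t h, fun h => key _ t h⟩
  · intro σ
    refine ⟨rad_pos hE0.compact (hyne σ) h0, ?_⟩
    have h1 := hOmK0 (hTmem σ)
    rw [show T σ • (v + σ • u) = T σ • v + (T σ * σ) • u by module, Om_inv hu, hD'] at h1
    exact h1.2
  · intro M
    obtain ⟨r, hr, hb⟩ := Metric.nhds_basis_closedBall.mem_iff.1 (mem_interior_iff_mem_nhds.1 h0)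
    have hvp : 0 < ‖v‖ := norm_pos_iff.2 hv
    refine ⟨r / (‖v‖ + |M|), by positivity, fun σ hσ => ?_⟩
    refine le_trans ?_ (rad_ge hE0.compact (hyne σ) hr hb)
    refine div_le_div_of_nonneg_left hr.le (norm_pos_iff.2 (hyne σ)) ?_
    refine (norm_add_le _ _).trans ?_
    rw [norm_smul, hu, mul_one, Real.norm_eq_abs]
    linarith [le_abs_self M]
  · intro q hq σ ν' hl hm
    set t := T σ with ht
    set a := t • (v + σ • u) with ha
    have hia : ⟪u, a⟫ = t * σ := by
      rw [ha, inner_smul_right, inner_add_right, inner_smul_right, huv, inner_self_unit hu]; ring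
    have hpi : q • v ∈ interior (Om u K) :=
      interior_mono hOmK0 (mem_interior_of_lt_rad hE0.compact hE0.convex hs hv h0 hq)
    have hMa : Mu u K a = Mu u K (t • v) := by
      rw [ha, show t • (v + σ • u) = t • v + (t * σ) • u by module, Mu_inv hu]
    have hMa' : Mu u K (-a) = Mu u K ((-t) • v) := by
      rw [ha, show -(t • (v + σ • u)) = (-t) • v + (-(t * σ)) • u by module, Mu_inv hu]
    have lin : ∀ c : ℝ, HasDerivAt (fun s : ℝ => q + s * c) c 0 := fun c => by
      simpa using ((hasDerivAt_id (0:ℝ)).mul_const c).const_add q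
    have comp : ∀ (f : ℝ → ℝ) (f' c : ℝ), HasDerivAt f f' q →
        HasDerivAt (fun s : ℝ => f (q + s * c)) (f' * c) 0 := fun f f' c hf =>
      HasDerivAt.comp (h₂ := f) (0:ℝ) (by simpa using hf) (lin c)
    have eq1 : ∀ s : ℝ, q • v - s • a = (q + s * (-t)) • v + (-(s * t * σ)) • u := by
      intro s; rw [ha]; module
    have eq2 : ∀ s : ℝ, q • v - s • (-a) = (q + s * t) • v + (s * t * σ) • u := by
      intro s; rw [ha]; module
    have r1 := key_deriv hu hE hs (hTmem σ) (hTnot σ) hpi (A := ν' * (-t))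
      (by simp only [← ht, ← ha, eq1, Ll_inv hu, hia]
          exact (comp _ _ (-t) hl).congr_deriv (by ring))
      (by simp only [← ht, ← ha, eq1, Mu_inv hu]; exact comp _ _ (-t) hm)
    have r2 := key_deriv hu hE hs (hs _ (hTmem σ)) (hneg_int _ (hTnot σ)) hpi (A := ν' * t)
      (by simp only [← ht, ← ha, eq2, Ll_inv hu, inner_neg_right, hia]
          exact (comp _ _ t hl).congr_deriv (by ring))
      (by simp only [← ht, ← ha, eq2, Mu_inv hu]; exact comp _ _ t hm)
    simp only [← ht, ← ha, hMa, hMa', ← neg_smul] at r1 r2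
    constructor <;> linarith

theorem sym_step {n : ℕ} {u : Eu (n+1)} (hu : ‖u‖ = 1) {K : Set (Eu (n+1))} (hE : Extremal K)
    (hs : ∀ x ∈ St u K, -x ∈ St u K) : ∃ e : ℝ, ∀ x ∈ K, (2 * e) • u - x ∈ K := by
  have hK := hE.compact
  have hKc := hE.convex
  have hE0 := hE.St hu
  have h0 : (0 : Eu (n+1)) ∈ St u K := interior_subset (zero_mem_interior hE0.convex hE0.int hs)
  have h0' : (0 : Eu (n+1)) ∈ Om u K := by
    rw [← Pt_self (u := u) (0 : Eu (n+1))] at h0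
    exact ((mem_St_iff hu hK hKc).1 h0).1
  have hmu : ∀ x ∈ Om u K, Mu u K x + Mu u K (-x) = 2 * Mu u K 0 := by
    intro x hx
    set v := x + (-⟪u, x⟫) • u with hv
    have huv : ⟪u, v⟫ = 0 := by
      rw [hv, inner_add_right, inner_smul_right, inner_self_unit hu]; ring
    have e1 : Mu u K x = Mu u K v := by rw [hv, Mu_inv hu]
    have e2 : Mu u K (-x) = Mu u K (-v) := by
      rw [show -v = -x + ⟪u,x⟫ • u by rw [hv]; module, Mu_inv hu]
    have hvO : v ∈ Om u K := by rw [hv, Om_inv hu]; exact hx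
    by_cases hv0 : v = 0
    · rw [e1, e2, hv0, neg_zero]; ring
    obtain ⟨A, e, h⟩ := mu_line hu hE hs huv hv0
    have q1 := h 1 (by rwa [one_smul])
    have q2 := h (-1) (by rw [neg_smul, one_smul]; exact Om_neg hu hK hKc hs hvO)
    have q0 := h 0 (by rwa [zero_smul])
    rw [one_smul] at q1; rw [neg_smul, one_smul] at q2; rw [zero_smul] at q0
    rw [e1, e2]; linarith
  refine ⟨Mu u K 0, fun x hx => ?_⟩
  rw [← Pt_self (u := u) x, Pt_mem_iff hu hK hKc] at hx
  obtain ⟨hO, h1, h2⟩ := hx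
  have hO' := Om_neg hu hK hKc hs hO
  have hm := hmu x hO
  have hl := Ll_neg hu hK hKc hs hO
  have : (2 * Mu u K 0) • u - x = Pt u (-x) (2 * Mu u K 0 - ⟪u, x⟫) := by
    simp only [Pt, inner_neg_right]; module
  rw [this, Pt_mem_iff hu hK hKc]
  refine ⟨hO', ?_, ?_⟩ <;> simp only [Mu, Ll] at * <;> linarith

lemma rho_St {d : ℕ} {u w : Eu d} (hu : ‖u‖ = 1) (hw : ‖w‖ = 1) (huw : ⟪w, u⟫ = 0) {K : Set (Eu d)}
    (h : ∀ x ∈ K, rho w x ∈ K) : ∀ x ∈ St u K, rho w x ∈ St u K := by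
  intro z hz
  rw [mem_St hu] at hz ⊢
  obtain ⟨t, h1, h2⟩ := hz
  have hfix : rho w u = u := by rw [rho_apply hw, huw]; simp
  have hin : ⟪u, rho w z⟫ = ⟪u, z⟫ := by
    rw [rho_apply hw, inner_sub_right, inner_smul_right, real_inner_comm w u, huw]; simp
  refine ⟨t, ?_, ?_⟩
  · have := h _ h1; rwa [map_add, map_smul, hfix] at this
  · have := h _ h2; rwa [map_add, map_smul, hfix, ← hin] at this

lemma St_translate_sym {d : ℕ} {u z : Eu d} (hu : ‖u‖ = 1) (huz : ⟪u, z⟫ = 0) {K : Set (Eu d)}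
    (h : ∀ x ∈ St u K, (2:ℝ) • z - x ∈ St u K) :
    ∀ x ∈ St u ((fun x => -z + x) '' K), -x ∈ St u ((fun x => -z + x) '' K) := by
  have key : ∀ x, x ∈ St u ((fun x => -z + x) '' K) ↔ z + x ∈ St u K := by
    intro x
    rw [mem_St hu, mem_St hu]
    have e : ∀ y, y ∈ (fun x => -z + x) '' K ↔ z + y ∈ K := by
      intro y
      constructor
      · rintro ⟨k, hk, rfl⟩; simpa using hk
      · intro h; exact ⟨_, h, by simp⟩
    simp only [e, inner_add_right, huz, zero_add, add_assoc]
  intro x hx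
  rw [key] at hx ⊢
  convert h _ hx using 1
  module

theorem sym_ind {n : ℕ} (S : Finset (Fin (n+1))) : ∀ K : Set (Eu (n+1)), Extremal K →
    (∀ i ∉ S, ∀ x ∈ K, rho (EuclideanSpace.single i (1:ℝ)) x ∈ K) →
    ∃ z : Eu (n+1), (∀ i ∉ S, z i = 0) ∧ ∀ x ∈ K, (2:ℝ) • z - x ∈ K := by
  have hn : ∀ i : Fin (n+1), ‖(EuclideanSpace.single i (1:ℝ) : Eu (n+1))‖ = 1 := fun i => by simp
  have hin : ∀ (i : Fin (n+1)) (x : Eu (n+1)), ⟪(EuclideanSpace.single i (1:ℝ) : Eu (n+1)), x⟫ = x i :=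
    fun i x => by simp [EuclideanSpace.inner_single_left]
  classical
  induction S using Finset.induction_on with
  | empty =>
    intro K hE h
    refine ⟨0, by simp, fun x hx => ?_⟩
    have : ∀ T : Finset (Fin (n+1)), ∃ y ∈ K, ∀ i, y i = if i ∈ T then - x i else x i := by
      intro T
      induction T using Finset.induction_on with
      | empty => exact ⟨x, hx, by simp⟩
      | insert j T hj ih =>
        obtain ⟨y, hy, hyi⟩ := ih
        refine ⟨_, h j (by simp) y hy, fun i => ?_⟩
        rw [rho_apply (hn j), hin]
        by_cases hij : i = j
        · subst hij
          simp [hyi, hj]; ring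
        · simp [hyi, hij, hj]
    obtain ⟨y, hy, hyi⟩ := this Finset.univ
    have : y = (2:ℝ) • (0 : Eu (n+1)) - x := by ext i; simp [hyi]
    rwa [← this]
  | insert j S hj ih =>
    intro K hE h
    obtain ⟨z', hz0, hz⟩ := ih (St (EuclideanSpace.single j (1:ℝ)) K) (hE.St (hn j)) (by
      intro i hi x hx
      by_cases hij : i = j
      · subst hij; exact St_rho_inv (hn i) hx
      · exact rho_St (hn j) (hn i) (by rw [hin]; simp [hij]) (h i (by simp [hij, hi])) x hx)
    obtain ⟨e, he⟩ := sym_step (hn j) (hE.translate (-z'))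
      (St_translate_sym (hn j) (by rw [hin]; exact hz0 j hj) hz)
    refine ⟨z' + e • EuclideanSpace.single j (1:ℝ), ?_, ?_⟩
    · intro i hi
      simp only [Finset.mem_insert, not_or] at hi
      simp [hz0 i hi.2, hi.1]
    · intro x hx
      obtain ⟨k, hk, hke⟩ := he _ ⟨x, hx, rfl⟩
      convert hk using 1
      have : k = z' + ((2 * e) • EuclideanSpace.single j (1:ℝ) - (-z' + x)) := by
        rw [← hke]; simp
      rw [this]; module

theorem Extremal.exists_center {n : ℕ} {K : Set (Eu (n+1))} (hE : Extremal K) :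
    ∃ z : Eu (n+1), ∀ x ∈ K, (2:ℝ) • z - x ∈ K := by
  obtain ⟨z, _, h⟩ := sym_ind Finset.univ K hE (by simp)
  exact ⟨z, h⟩

lemma exists_diff {d : ℕ} {f g : Eu d → ℝ} {O : Set (Eu d)} (hf : ConcaveOn ℝ O f)
    (hg : ConcaveOn ℝ O g) {R r : ℝ} (hr : 0 < r) (hb : ball 0 r ⊆ O) (hfR : ∀ x ∈ O, |f x| ≤ R)
    (hgR : ∀ x ∈ O, |g x| ≤ R) :
    ∃ p ∈ ball (0 : Eu d) r, DifferentiableAt ℝ f p ∧ DifferentiableAt ℝ g p := by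
  have key : ∀ f : Eu d → ℝ, ConcaveOn ℝ O f → (∀ x ∈ O, |f x| ≤ R) →
      ∀ᵐ x, x ∈ ball (0 : Eu d) (r/2) → DifferentiableAt ℝ f x := by
    intro f hf hfR
    have h1 := (hf.subset hb (convex_ball _ _)).lipschitzOnWith_of_abs_le
      (ε := r/2) (M := R) (by linarith) (fun q hq => hfR _ (hb hq))
    rw [show r - r/2 = r/2 by ring] at h1
    filter_upwards [h1.ae_differentiableWithinAt_of_mem (μ := volume)] with x hx hx'
    exact (hx hx').differentiableAt (isOpen_ball.mem_nhds hx')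
  have hpos : volume (ball (0 : Eu d) (r/2)) ≠ 0 := (measure_ball_pos _ _ (by linarith)).ne'
  obtain ⟨p, hp, h⟩ := ((frequently_ae_mem_iff.2 hpos).and_eventually
    ((key f hf hfR).and (key g hg hgR))).exists
  exact ⟨p, ball_subset_ball (by linarith) hp, h.1 hp, h.2 hp⟩

lemma St_symm {d : ℕ} {u : Eu d} (hu : ‖u‖ = 1) {K : Set (Eu d)} (hs : ∀ x ∈ K, -x ∈ K) :
    ∀ x ∈ St u K, -x ∈ St u K := by
  intro z hz
  rw [mem_St hu] at hz ⊢
  obtain ⟨t, h1, h2⟩ := hz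
  refine ⟨-t, ?_, ?_⟩
  · convert hs _ h1 using 1; module
  · convert hs _ h2 using 1; rw [inner_neg_right]; module

lemma Mu_odd {d : ℕ} {u : Eu d} (hu : ‖u‖ = 1) {K : Set (Eu d)} (hs : ∀ x ∈ K, -x ∈ K) (x : Eu d) :
    Mu u K (-x) = - Mu u K x := by
  have h1 : ∀ x, Gt u K (-x) = Gt u (rho u '' K) x := by
    intro x
    simp only [Gt, Pt_mem_rho hu]
    congr 1
    ext h
    have e : Pt u (-x) h = - Pt u x (-h) := by rw [← Pt_neg, neg_neg]
    simp only [mem_setOf_eq, e]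
    exact ⟨fun h => by simpa using hs _ h, fun h => hs _ h⟩
  have h2 : Gt u (rho u '' K) (-x) = Gt u K x := by rw [← h1, neg_neg]
  simp only [Mu, h1, h2]; ring

theorem exists_psi {n : ℕ} {u : Eu (n+1)} (hu : ‖u‖ = 1) {K : Set (Eu (n+1))} (hE : Extremal K)
    (hs : ∀ x ∈ K, -x ∈ K) :
    ∃ ψ : Eu (n+1) →ₗ[ℝ] ℝ, ψ u = -2 ∧ ∀ x ∈ K, x + ψ x • u ∈ K := by
  have hK := hE.compact
  have hKc := hE.convex
  have hE0 := hE.St hu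
  have hE' := hE.rho u
  have hsS := St_symm hu hs
  set K0 := St u K with hK0
  have hOmK0 : K0 ⊆ Om u K := by
    intro z hz
    rw [← Pt_self (u := u) z] at hz
    exact ((mem_St_iff hu hK hKc).1 hz).1
  have h0 : (0 : Eu (n+1)) ∈ interior K0 := zero_mem_interior hE0.convex hE0.int hsS
  have hmu0 : Mu u K 0 = 0 := by
    have := Mu_odd hu hs 0
    rw [neg_zero] at this; linarith
  obtain ⟨r, hr, hb⟩ := Metric.nhds_basis_ball.mem_iff.1 (mem_interior_iff_mem_nhds.1 h0)
  obtain ⟨R1, hR1⟩ := Gt_bdd hu hK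
  obtain ⟨R2, hR2⟩ := Gt_bdd hu hE'.compact
  have hc2 := Gt_concave hu hE'.compact hE'.convex
  rw [Om_rho hu] at hR2 hc2
  obtain ⟨p, hp, hd1, hd2⟩ := exists_diff (Gt_concave hu hK hKc) hc2 hr (hb.trans hOmK0)
    (R := max R1 R2) (fun x hx => (hR1 x hx).trans (le_max_left _ _))
    (fun x hx => (hR2 x hx).trans (le_max_right _ _))
  have hpi : p ∈ interior (Om u K) := mem_interior.2 ⟨_, hb.trans hOmK0, isOpen_ball, hp⟩
  have hdL : DifferentiableAt ℝ (Ll u K) p := by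
    change DifferentiableAt ℝ (fun x => (Gt u K x + Gt u (rho u '' K) x) / 2) p
    simp only [div_eq_mul_inv]
    fun_prop
  have hdM : DifferentiableAt ℝ (Mu u K) p := by
    change DifferentiableAt ℝ (fun x => (Gt u K x - Gt u (rho u '' K) x) / 2) p
    simp only [div_eq_mul_inv]
    fun_prop
  set g := fderiv ℝ (Mu u K) p
  set lam := fderiv ℝ (Ll u K) p
  have lin : ∀ a : Eu (n+1), HasDerivAt (fun s : ℝ => p - s • a) (-a) 0 := fun a => by
    simpa using ((hasDerivAt_id (0:ℝ)).smul_const a).const_sub p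
  have comp : ∀ (f : Eu (n+1) → ℝ) (a : Eu (n+1)), DifferentiableAt ℝ f p →
      HasDerivAt (fun s : ℝ => f (p - s • a)) (- fderiv ℝ f p a) 0 := by
    intro f a hf
    have := HasFDerivAt.comp_hasDerivAt (l := f) (0:ℝ) (by simpa using hf.hasFDerivAt) (lin a)
    exact this.congr_deriv (by simp)
  have hz : ∀ f : Eu (n+1) → ℝ, DifferentiableAt ℝ f p → (∀ (x : Eu (n+1)) (s : ℝ), f (x + s • u) = f x) →
      fderiv ℝ f p u = 0 := by
    intro f hf hinv
    have h1 := comp f u hf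
    have h2 : (fun s : ℝ => f (p - s • u)) = fun _ => f p := by
      funext s; rw [sub_eq_add_neg, ← neg_smul, hinv]
    rw [h2] at h1
    have := h1.unique (hasDerivAt_const (0:ℝ) (f p))
    linarith
  have hgu : g u = 0 := hz _ hdM (Mu_inv hu K)
  have hlu : lam u = 0 := hz _ hdL (Ll_inv hu K)
  have hmain : ∀ x ∈ Om u K, Mu u K x = g x := by
    intro x hx
    set v := x + (-⟪u, x⟫) • u with hv
    have huv : ⟪u, v⟫ = 0 := by
      rw [hv, inner_add_right, inner_smul_right, inner_self_unit hu]; ring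
    have e1 : Mu u K x = Mu u K v := by rw [hv, Mu_inv hu]
    have e2 : g x = g v := by rw [hv, map_add, map_smul, hgu]; simp
    have hvO : v ∈ Om u K := by rw [hv, Om_inv hu]; exact hx
    rw [e1, e2]
    by_cases hv0 : v = 0
    · rw [hv0, map_zero, hmu0]
    obtain ⟨A, e, h⟩ := mu_line hu hE hsS huv hv0
    have q0 := h 0 (by rw [zero_smul]; exact hOmK0 (interior_subset h0))
    rw [zero_smul, hmu0] at q0
    have q1 := h 1 (by rwa [one_smul])
    rw [one_smul] at q1
    set y := v + (lam v) • u with hy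
    have hiy : ⟪u, y⟫ = lam v := by
      rw [hy, inner_add_right, inner_smul_right, inner_self_unit hu, huv]; ring
    have hly : lam y = lam v := by rw [hy, map_add, map_smul, hlu]; simp
    have hgy : g y = g v := by rw [hy, map_add, map_smul, hgu]; simp
    have hy0 : y ≠ 0 := by
      intro h
      rw [h, inner_zero_right] at hiy
      rw [hy, ← hiy] at h; simp at h; exact hv0 h
    set t := rad K0 y
    have ht : 0 < t := rad_pos hE0.compact hy0 h0
    have htm : t • y ∈ K0 := rad_mem hE0.compact hy0 (interior_subset h0)
    have hkey := key_deriv hu hE hsS htm (rad_not_mem hE0.compact hy0) hpi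
      ((comp _ (t • y) hdL).congr_deriv (by
        rw [inner_smul_right, hiy, map_smul]; change -(t • lam y) = _; rw [hly]; simp))
      (comp _ (t • y) hdM)
    have e3 : t • y = t • v + (t * lam v) • u := by rw [hy]; module
    rw [Mu_odd hu hs, map_smul] at hkey
    change 2 * (-(t • g y)) + _ - _ - _ = 0 at hkey
    have hmv : Mu u K (t • y) = Mu u K (t • v) := by rw [e3, Mu_inv hu]
    have hOt : t • v ∈ Om u K := by
      have := hOmK0 htm
      rwa [e3, Om_inv hu] at this
    have q2 := h t hOt
    rw [hmv, q2, hgy, smul_eq_mul] at hkey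
    have : t * (A - g v) = 0 := by linear_combination hkey / 2 + q0
    rcases mul_eq_zero.1 this with h | h
    · exact absurd h ht.ne'
    · linarith
  refine ⟨(2:ℝ) • ((g : Eu (n+1) →ₗ[ℝ] ℝ) - (innerSL ℝ u : Eu (n+1) →ₗ[ℝ] ℝ)), ?_, ?_⟩
  · simp [hgu, hu]
  · intro x hx
    rw [← Pt_self (u := u) x, Pt_mem_iff hu hK hKc] at hx
    obtain ⟨hO, h1, h2⟩ := hx
    have hm := hmain x hO
    have : x + ((2:ℝ) • ((g : Eu (n+1) →ₗ[ℝ] ℝ) - (innerSL ℝ u : Eu (n+1) →ₗ[ℝ] ℝ))) x • u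
        = Pt u x (2 * g x - ⟪u, x⟫) := by
      simp [Pt]; module
    rw [this, Pt_mem_iff hu hK hKc]
    refine ⟨hO, ?_, ?_⟩ <;> simp only [Mu] at hm <;> linarith

lemma exists_sqrt {d : ℕ} (M : Eu d →ₗ[ℝ] Eu d) (hM : M.IsSymmetric)
    (hp : ∀ x, x ≠ 0 → 0 < ⟪M x, x⟫) :
    ∃ C : Eu d ≃ₗ[ℝ] Eu d, (∀ x y, ⟪C x, y⟫ = ⟪x, C y⟫) ∧ ∀ x, C (C x) = M x := by
  have hfr : Module.finrank ℝ (Eu d) = d := by simp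
  set b := hM.eigenvectorBasis hfr with hb
  set e := hM.eigenvalues hfr with he
  have hbe : ∀ i, M (b i) = e i • b i := fun i => by
    have := hM.apply_eigenvectorBasis hfr i
    exact this
  have hpos : ∀ i, 0 < e i := by
    intro i
    have h1 := hp (b i) (b.orthonormal.ne_zero i)
    rw [hbe, inner_smul_left, real_inner_self_eq_norm_sq, b.orthonormal.1 i] at h1
    simpa using h1
  set C : Eu d →ₗ[ℝ] Eu d := ∑ i, Real.sqrt (e i) • ((innerₛₗ ℝ (b i)).smulRight (b i)) with hC
  have hCx : ∀ x, C x = ∑ i, (Real.sqrt (e i) * ⟪b i, x⟫) • b i := fun x => by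
    simp [hC, LinearMap.sum_apply, smul_smul]
  have hCb : ∀ j, C (b j) = Real.sqrt (e j) • b j := by
    intro j
    rw [hCx, Finset.sum_eq_single j]
    · rw [real_inner_self_eq_norm_sq, b.orthonormal.1 j]; simp
    · intro i _ hij
      rw [b.orthonormal.2 hij]; simp
    · simp
  have hCC : ∀ x, C (C x) = M x := by
    have : C ∘ₗ C = M := by
      refine b.toBasis.ext fun j => ?_
      simp only [OrthonormalBasis.coe_toBasis, LinearMap.comp_apply]
      rw [hCb, map_smul, hCb, hbe, smul_smul, Real.mul_self_sqrt (hpos j).le]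
    intro x; rw [← this]; rfl
  have hinj : Function.Injective C := by
    rw [← LinearMap.ker_eq_bot, LinearMap.ker_eq_bot']
    intro x hx
    by_contra h
    have h1 := hp x h
    rw [← hCC, hx, map_zero, inner_zero_left] at h1
    exact lt_irrefl _ h1
  refine ⟨LinearEquiv.ofInjectiveEndo C hinj, ?_, ?_⟩
  · intro x y
    change ⟪C x, y⟫ = ⟪x, C y⟫
    simp only [hCx, sum_inner, inner_sum, inner_smul_left,
      inner_smul_right]
    refine Finset.sum_congr rfl fun i _ => ?_
    rw [real_inner_comm x (b i)]; simp; ring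
  · intro x; exact hCC x

lemma moment_inv {d : ℕ} {K : Set (Eu d)} (hK : IsCompact K) (R : Eu d →ₗ[ℝ] Eu d)
    (hR : ∀ x ∈ K, R x ∈ K) (hRR : ∀ x, R (R x) = x) (f : Eu d → ℝ) :
    ∫ x in K, f (R x) = ∫ x in K, f x := by
  have him : R '' K = K := by
    ext x
    constructor
    · rintro ⟨y, hy, rfl⟩; exact hR y hy
    · intro hx; exact ⟨R x, hR x hx, hRR x⟩
  set R' : Eu d →L[ℝ] Eu d := LinearMap.toContinuousLinearMap R
  have hdet : |R'.det| = 1 := by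
    have h1 : R ∘ₗ R = LinearMap.id := LinearMap.ext hRR
    have h2 := congrArg LinearMap.det h1
    rw [LinearMap.det_comp, LinearMap.det_id] at h2
    have h3 : R'.det = LinearMap.det R := by simp [R', ContinuousLinearMap.det]
    rw [h3]
    have h4 : |LinearMap.det R| * |LinearMap.det R| = 1 := by rw [← abs_mul, h2, abs_one]
    nlinarith [abs_nonneg (LinearMap.det R)]
  have := integral_image_eq_integral_abs_det_fderiv_smul (volume : Measure (Eu d)) (f := R)
    (f' := fun _ => R') hK.measurableSet (fun x _ => R'.hasFDerivAt.hasFDerivWithinAt)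
    (fun x _ y _ h => by rw [← hRR x, h, hRR]) f
  rw [him] at this
  rw [this]
  simp [hdet]

lemma ball_of_rho {d : ℕ} {K : Set (Eu d)} (hK : IsCompact K) (hKc : Convex ℝ K)
    (h0 : (0 : Eu d) ∈ interior K) (h : ∀ u : Eu d, ‖u‖ = 1 → ∀ x ∈ K, rho u x ∈ K) (hd : 0 < d) :
    ∃ r > 0, K = closedBall 0 r := by
  have h00 := interior_subset h0
  obtain ⟨x, hx, hmax⟩ := hK.exists_isMaxOn ⟨0, h00⟩ continuous_norm.continuousOn
  have hmax : ∀ y ∈ K, ‖y‖ ≤ ‖x‖ := hmax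
  have hmem : ∀ y : Eu d, ‖y‖ = ‖x‖ → y ∈ K := by
    intro y hy
    by_cases hxy : x = y
    · rwa [← hxy]
    have hne : 0 < ‖x - y‖ := norm_pos_iff.2 (sub_ne_zero.2 hxy)
    have hu1 : ‖(‖x - y‖⁻¹) • (x - y)‖ = 1 := by
      rw [norm_smul, norm_inv, norm_norm, inv_mul_cancel₀ hne.ne']
    have := h _ hu1 x hx
    rw [rho_apply hu1, inner_smul_left, smul_smul] at this
    have e1 : ‖x - y‖^2 = 2 * ⟪x - y, x⟫ := by
      rw [norm_sub_sq_real, inner_sub_left, real_inner_self_eq_norm_sq, hy, real_inner_comm]; ring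
    have e2 : 2 * ((starRingEnd ℝ) ‖x - y‖⁻¹ * ⟪x - y, x⟫) * ‖x - y‖⁻¹ = 1 := by
      simp only [conj_trivial]
      field_simp
      linarith
    rw [e2, one_smul, sub_sub_cancel] at this
    exact this
  obtain ⟨r, hr, hb⟩ := Metric.nhds_basis_closedBall.mem_iff.1 (mem_interior_iff_mem_nhds.1 h0)
  have hxp : 0 < ‖x‖ := by
    have h1 : EuclideanSpace.single (⟨0, hd⟩ : Fin d) r ∈ K := hb (by simp [abs_of_pos hr])
    have h2 := hmax _ h1
    simp [abs_of_pos hr] at h2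
    linarith
  refine ⟨‖x‖, hxp, ?_⟩
  ext y
  rw [mem_closedBall_zero_iff]
  refine ⟨hmax y, fun hy => ?_⟩
  by_cases hy0 : y = 0
  · rwa [hy0]
  have hyp : 0 < ‖y‖ := norm_pos_iff.2 hy0
  have h1 : (‖x‖/‖y‖) • y ∈ K := hmem _ (by
    rw [norm_smul, norm_div, norm_norm, norm_norm]; field_simp)
  have h2 := hKc h00 h1 (a := 1 - ‖y‖/‖x‖) (b := ‖y‖/‖x‖)
    (by rw [sub_nonneg, div_le_one hxp]; exact hy) (by positivity) (by ring)
  rw [smul_zero, zero_add, smul_smul] at h2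
  have e : ‖y‖/‖x‖ * (‖x‖/‖y‖) = 1 := by field_simp
  rwa [e, one_smul] at h2

theorem ellipsoid_of_sym {n : ℕ} {K : Set (Eu (n+1))} (hE : Extremal K) (hs : ∀ x ∈ K, -x ∈ K) :
    ∃ C : Eu (n+1) ≃ₗ[ℝ] Eu (n+1), ∃ r > 0, K = C '' closedBall 0 r := by
  have hK := hE.compact
  have h0 : (0 : Eu (n+1)) ∈ interior K := zero_mem_interior hE.convex hE.int hs
  have hIntg : ∀ f : Eu (n+1) → ℝ, Continuous f → IntegrableOn f K := fun f hf =>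
    hf.continuousOn.integrableOn_compact hK
  have hIntg' : ∀ f : Eu (n+1) → Eu (n+1), Continuous f → IntegrableOn f K := fun f hf =>
    hf.continuousOn.integrableOn_compact hK
  let M : Eu (n+1) →ₗ[ℝ] Eu (n+1) :=
    { toFun := fun a => ∫ x in K, ⟪a, x⟫ • x
      map_add' := fun a b => by
        rw [← integral_add (hIntg' _ (by fun_prop)) (hIntg' _ (by fun_prop))]
        simp only [inner_add_left, add_smul]
      map_smul' := fun c a => by
        rw [RingHom.id_apply, ← integral_smul]
        simp only [inner_smul_left, smul_smul]; rfl }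
  have hM : ∀ a b, ⟪M a, b⟫ = ∫ x in K, ⟪a, x⟫ * ⟪b, x⟫ := by
    intro a b
    change ⟪∫ x in K, ⟪a, x⟫ • x, b⟫ = _
    rw [real_inner_comm, ← integral_inner (hIntg' _ (by fun_prop))]
    simp only [inner_smul_right]
  have hMs : M.IsSymmetric := by
    intro a b
    rw [hM, real_inner_comm, hM]
    simp only [mul_comm]
  have hMp : ∀ a, a ≠ 0 → 0 < ⟪M a, a⟫ := by
    intro a ha
    rw [hM, setIntegral_pos_iff_support_of_nonneg_ae
      (Eventually.of_forall fun x => mul_self_nonneg _) (hIntg _ (by fun_prop))]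
    have hop : IsOpen (Function.support (fun x : Eu (n+1) => ⟪a, x⟫ * ⟪a, x⟫) ∩ interior K) :=
      (Continuous.isOpen_support (by fun_prop)).inter isOpen_interior
    refine lt_of_lt_of_le (hop.measure_pos volume ?_)
      (measure_mono (inter_subset_inter_right _ interior_subset))
    have hc : ContinuousAt (fun t : ℝ => t • a) 0 := by fun_prop
    have h1 : ∀ᶠ t in 𝓝[>] (0:ℝ), t • a ∈ interior K :=
      (hc.eventually_mem (isOpen_interior.mem_nhds (by simpa using h0))).filter_mono nhdsWithin_le_nhds
    obtain ⟨t, ht, ht'⟩ := (h1.and self_mem_nhdsWithin).exists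
    refine ⟨t • a, ?_, ht⟩
    have ht'' : t ≠ 0 := ne_of_gt ht'
    simp [inner_smul_right, ha, ht'']
  obtain ⟨C, hCs, hCC⟩ := exists_sqrt M hMs hMp
  have hpre : ∀ x, x ∈ C.symm '' K ↔ C x ∈ K := by
    intro x
    constructor
    · rintro ⟨k, hk, rfl⟩; simpa using hk
    · intro h; exact ⟨_, h, by simp⟩
  obtain ⟨r, hr, h⟩ := ball_of_rho (K := C.symm '' K)
    (hK.image C.symm.toLinearMap.continuous_of_finiteDimensional)
    (hE.convex.linear_image C.symm.toLinearMap) (by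
      have h1 := (C.symm.toContinuousLinearEquiv.toHomeomorph).image_interior K
      have h2 : (0 : Eu (n+1)) ∈ (C.symm.toContinuousLinearEquiv.toHomeomorph) '' interior K :=
        ⟨0, h0, by simp⟩
      rw [h1] at h2; exact h2) (by
      intro u hu x hx
      rw [hpre] at hx ⊢
      have hCu : 0 < ‖C u‖ := norm_pos_iff.2 (by
        intro h
        have : u = 0 := by simpa using h
        rw [this] at hu; simp at hu)
      set u1 := ‖C u‖⁻¹ • C u with hu1
      have hu1n : ‖u1‖ = 1 := by rw [hu1, norm_smul, norm_inv, norm_norm, inv_mul_cancel₀ hCu.ne']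
      obtain ⟨ψ, hψu, hψ⟩ := exists_psi hu1n hE hs
      set w := (InnerProductSpace.toDual ℝ (Eu (n+1))).symm (LinearMap.toContinuousLinearMap ψ) with hw
      have hwx : ∀ y, ψ y = ⟪w, y⟫ := fun y => by
        rw [hw, InnerProductSpace.toDual_symm_apply]; rfl
      set R : Eu (n+1) →ₗ[ℝ] Eu (n+1) := LinearMap.id + ψ.smulRight u1 with hR
      have hRx : ∀ y, R y = y + ψ y • u1 := fun y => by simp [hR]
      have hRR : ∀ y, R (R y) = y := by
        intro y
        rw [hRx (R y), hRx y, map_add, map_smul, hψu]; module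
      have hmom : ∀ b, ⟪M w, b⟫ = - ⟪M w, b⟫ - ⟪b, u1⟫ * ⟪M w, w⟫ := by
        intro b
        have h1 := moment_inv hK R (fun y hy => by rw [hRx]; exact hψ y hy) hRR
          (fun y => ⟪w, y⟫ * ⟪b, y⟫)
        have h2 : ∀ y, ⟪w, R y⟫ * ⟪b, R y⟫ = -(⟪w,y⟫ * ⟪b,y⟫) + (-⟪b,u1⟫) * (⟪w, y⟫ * ⟪w, y⟫) := by
          intro y
          rw [← hwx, hRx, map_add, map_smul, hψu, inner_add_right, inner_smul_right, hwx]
          simp; ring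
        simp only [h2] at h1
        rw [integral_add (hIntg _ (by fun_prop)) (hIntg _ (by fun_prop)), integral_neg,
          integral_const_mul, ← hM, ← hM] at h1
        linarith
      have hw' : C (C w) = (-(⟪M w, w⟫ / 2)) • u1 := by
        rw [hCC]
        refine ext_inner_right ℝ fun b => ?_
        rw [inner_smul_left, real_inner_comm b u1]
        have := hmom b
        simp; linarith
      have hw2 : C w = (-(⟪M w, w⟫ / 2) * ‖C u‖⁻¹) • u := by
        apply C.injective
        rw [hw', hu1, map_smul, smul_smul]
      set c := -(⟪M w, w⟫ / 2) * ‖C u‖⁻¹ with hc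
      have hψC : ∀ y, ψ (C y) = c * ⟪u, y⟫ := fun y => by
        rw [hwx, ← hCs, hw2, inner_smul_left]; simp
      have hcc : c = -2 * ‖C u‖ := by
        have h1 := hψC u
        rw [inner_self_unit hu, mul_one] at h1
        rw [← h1]
        have : C u = ‖C u‖ • u1 := by rw [hu1, smul_smul, mul_inv_cancel₀ hCu.ne', one_smul]
        rw [this, map_smul, hψu, norm_smul, hu1n]; simp; ring
      have h3 := hψ _ hx
      rw [hψC, hcc] at h3
      convert h3 using 1
      rw [rho_apply hu, map_sub, map_smul, hu1, smul_smul, sub_eq_add_neg, ← neg_smul]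
      congr 2
      field_simp) (Nat.succ_pos n)
  refine ⟨C, r, hr, ?_⟩
  rw [← h, image_image]; simp

lemma F_ball_le {n : ℕ} {r : ℝ} (hr : 0 ≤ r) {a : Eu (n+1)} (ha : ‖a‖ ≤ r) :
    F (closedBall (0 : Eu (n+1)) r) a ≤ kap n * volume (closedBall (0 : Eu (n+1)) r) := by
  rw [F_ball' hr, kap_ball hr]
  refine ENNReal.ofReal_le_ofReal ?_
  have := unitBallVol_pos n
  gcongr

lemma vol_affine {d : ℕ} (T : Eu d →ᵃ[ℝ] Eu d) (s : Set (Eu d)) :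
    volume (T '' s) = ENNReal.ofReal |LinearMap.det T.linear| * volume s := by
  have h : T '' s = (fun x => T 0 + x) '' (T.linear '' s) := by
    rw [image_image]
    refine image_congr fun x _ => ?_
    have := T.map_vadd 0 x
    simp at this
    rw [this, add_comm]
  rw [h, image_add_left, measure_preimage_add, Measure.addHaar_image_linearMap]

lemma Extremal.ellipsoid {n : ℕ} {K : Set (Eu (n+1))} (hE : Extremal K) :
    ∃ T : Eu (n+1) ≃ᵃ[ℝ] Eu (n+1), K = T '' closedBall 0 1 := by
  obtain ⟨z, hz⟩ := hE.exists_center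
  obtain ⟨C, r, hr, h⟩ := ellipsoid_of_sym (hE.translate (-z)) (by
    rintro _ ⟨x, hx, rfl⟩
    exact ⟨_, hz x hx, by module⟩)
  refine ⟨((LinearEquiv.smulOfNeZero ℝ (Eu (n+1)) r hr.ne').trans C).toAffineEquiv.trans
    (AffineEquiv.constVAdd ℝ (Eu (n+1)) z), ?_⟩
  have hb : closedBall (0 : Eu (n+1)) r = (fun x => r • x) '' closedBall (0 : Eu (n+1)) 1 := by
    have := smul_closedBall r (0 : Eu (n+1)) zero_le_one
    rw [smul_zero, Real.norm_eq_abs, abs_of_pos hr, mul_one] at this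
    rw [← this]; rfl
  have h2 : K = (fun x => z + x) '' ((fun x => -z + x) '' K) := by
    rw [image_image]; simp
  rw [h2, h, hb, image_image, image_image]
  rfl

lemma ellipsoid_le {n : ℕ} (T : Eu (n+1) ≃ᵃ[ℝ] Eu (n+1)) {a : Eu (n+1)}
    (ha : a ∈ T '' closedBall (0 : Eu (n+1)) 1) :
    F (T '' closedBall (0 : Eu (n+1)) 1) a ≤ kap n * volume (T '' closedBall (0 : Eu (n+1)) 1) := by
  obtain ⟨b, hb, rfl⟩ := ha
  have h1 := J_affine (T : Eu (n+1) →ᵃ[ℝ] Eu (n+1)) (closedBall 0 1) b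
  have h2 := vol_affine (T : Eu (n+1) →ᵃ[ℝ] Eu (n+1))
  simp only [AffineEquiv.coe_toAffineMap] at h1 h2
  rw [F, h1, h2, h2, mul_left_comm]
  exact mul_le_mul_right (F_ball_le zero_le_one (by simpa using hb)) _

theorem main_succ (n : ℕ) (K : Set (Eu (n+1)))
    (hKc : IsCompact K) (hKconv : Convex ℝ K) (hKint : (interior K).Nonempty) :
    sSup {v : ℝ | ∃ a : Eu (n+1), (K ∩ reflAbout a K).Nonempty ∧
        v = (volume (convexHull ℝ (K ∪ reflAbout a K))).toReal} ≥
      (1 + 2 * unitBallVol n / unitBallVol (n+1)) * (volume K).toReal ∧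
    (sSup {v : ℝ | ∃ a : Eu (n+1), (K ∩ reflAbout a K).Nonempty ∧
        v = (volume (convexHull ℝ (K ∪ reflAbout a K))).toReal} =
      (1 + 2 * unitBallVol n / unitBallVol (n+1)) * (volume K).toReal ↔
      ∃ T : Eu (n+1) ≃ᵃ[ℝ] Eu (n+1), K = T '' closedBall 0 1) := by
  have hp1 := unitBallVol_pos n
  have hp2 := unitBallVol_pos (n+1)
  have hset : {v : ℝ | ∃ a : Eu (n+1), (K ∩ reflAbout a K).Nonempty ∧
        v = (volume (convexHull ℝ (K ∪ reflAbout a K))).toReal} =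
      (fun a => (F K a).toReal) '' K := by
    ext v
    simp only [mem_setOf_eq, inter_refl_nonempty hKconv, mem_image]
    constructor
    · rintro ⟨a, h, rfl⟩; exact ⟨a, h, rfl⟩
    · rintro ⟨a, h, rfl⟩; exact ⟨a, h, rfl⟩
  rw [hset]
  set s := sSup ((fun a => (F K a).toReal) '' K) with hs
  have hKne : K.Nonempty := hKint.mono interior_subset
  have hvol : volume K ≠ ∞ := hKc.measure_lt_top.ne
  have hFt : ∀ a, F K a ≠ ∞ := fun a => (F_lt_top hKc hKconv a).ne
  have hbdd : BddAbove ((fun a => (F K a).toReal) '' K) := by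
    obtain ⟨R, hR⟩ := hKc.isBounded.subset_closedBall 0
    obtain ⟨x, hx⟩ := hKne
    have hR0 : 0 ≤ R := (norm_nonneg x).trans (by simpa using hR hx)
    refine ⟨(kap n * volume (closedBall (0 : Eu (n+1)) R)).toReal, ?_⟩
    rintro _ ⟨a, ha, rfl⟩
    refine ENNReal.toReal_mono ?_ ((F_mono hR a).trans (F_ball_le hR0 (by simpa using hR ha)))
    exact ENNReal.mul_ne_top ENNReal.ofReal_ne_top (isCompact_closedBall _ _).measure_lt_top.ne
  have hs0 : 0 ≤ s := by
    obtain ⟨x, hx⟩ := hKne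
    exact ENNReal.toReal_nonneg.trans (le_csSup hbdd ⟨x, hx, rfl⟩)
  have hFs : ∀ a ∈ K, F K a ≤ ENNReal.ofReal s := by
    intro a ha
    rw [← ENNReal.ofReal_toReal (hFt a)]
    exact ENNReal.ofReal_le_ofReal (le_csSup hbdd ⟨a, ha, rfl⟩)
  have hkv : ENNReal.ofReal ((1 + 2 * unitBallVol n / unitBallVol (n+1)) * (volume K).toReal) =
      kap n * volume K := by
    rw [ENNReal.ofReal_mul (by positivity), ENNReal.ofReal_toReal hvol, kap]
  have hge : s ≥ (1 + 2 * unitBallVol n / unitBallVol (n+1)) * (volume K).toReal := by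
    have := main_ineq hKc hKconv hKint hFs
    rw [← hkv] at this
    exact (ENNReal.ofReal_le_ofReal_iff hs0).1 this
  refine ⟨hge, ?_, ?_⟩
  · intro h
    refine Extremal.ellipsoid ⟨hKc, hKconv, hKint, fun a ha => ?_⟩
    rw [← hkv, ← h]; exact hFs a ha
  · rintro ⟨T, hT⟩
    refine le_antisymm ?_ hge
    refine csSup_le (hKne.image _) ?_
    rintro _ ⟨a, ha, rfl⟩
    have h1 : F K a ≤ kap n * volume K := by
      rw [hT] at ha ⊢; exact ellipsoid_le T ha
    rw [← hkv] at h1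
    refine ENNReal.toReal_le_of_le_ofReal (by positivity) h1

/-- G.Horváth–Lángi (Rogers–Shephard conjecture for point reflections): for a convex body
`K` in Euclidean `d`-space, the supremum over points `a` with `K ∩ ((2•a) − K) ≠ ∅` of
`vol(convexHull ℝ (K ∪ ((2•a) − K)))` is at least `(1 + 2·v_{d−1}/v_d)·vol(K)`, with
equality if and only if `K` is an ellipsoid. -/
theorem point_reflection_hull_volume_ge (d : ℕ) (hd : 2 ≤ d)
    (K : Set (EuclideanSpace ℝ (Fin d)))
    (hKc : IsCompact K) (hKconv : Convex ℝ K) (hKint : (interior K).Nonempty) :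
    sSup {v : ℝ | ∃ a : EuclideanSpace ℝ (Fin d), (K ∩ reflAbout a K).Nonempty ∧
        v = (volume (convexHull ℝ (K ∪ reflAbout a K))).toReal} ≥
      (1 + 2 * unitBallVol (d - 1) / unitBallVol d) * (volume K).toReal ∧
    (sSup {v : ℝ | ∃ a : EuclideanSpace ℝ (Fin d), (K ∩ reflAbout a K).Nonempty ∧
        v = (volume (convexHull ℝ (K ∪ reflAbout a K))).toReal} =
      (1 + 2 * unitBallVol (d - 1) / unitBallVol d) * (volume K).toReal ↔
      ∃ T : EuclideanSpace ℝ (Fin d) ≃ᵃ[ℝ] EuclideanSpace ℝ (Fin d),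
        K = T '' Metric.closedBall 0 1) := by
  obtain ⟨n, rfl⟩ : ∃ n, d = n + 1 := ⟨d - 1, by omega⟩
  simpa only [Nat.add_sub_cancel] using main_succ n K hKc hKconv hKint
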